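/- arXiv:1605.02499 — 5 statements merged into one kernel-verified Lean document; each statement's English description precedes it below -/
import Mathlib

section
/- Let ℛ = {R₁, …, Rₙ} be a finite family of convex bodies in ℝ² forming convex pseudodisks, and suppose ℛ is cover-free, i.e., CF(Rⱼ, ℛ) := Rⱼ \ ⋃_{i ≠ j} Rᵢ is nonempty for every j. Then there exist convex sets R̃₁, …, R̃ₙ such that: (i) R̃ⱼ ⊆ Rⱼ for every j; (ii) the R̃ⱼ have pairwise disjoint interiors, i.e., interior(R̃ᵢ) ∩ interior(R̃ⱼ) = ∅ for all i ≠ j; (iii) ⋃ⱼ R̃ⱼ = ⋃ⱼ Rⱼ; and (iv) CF(Rⱼ, ℛ) ⊆ R̃ⱼ for every j. -/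
open Set

/-- The Euclidean plane. -/
abbrev Plane := EuclideanSpace ℝ (Fin 2)

/-- A convex body: compact, convex, with nonempty interior. -/
def IsConvexBody (S : Set Plane) : Prop :=
  IsCompact S ∧ Convex ℝ S ∧ (interior S).Nonempty

/-- The cover-free region of the `j`-th member of the indexed family `R`. -/
def CFidx {n : ℕ} (R : Fin n → Set Plane) (j : Fin n) : Set Plane :=
  R j \ ⋃ (i : Fin n) (_ : i ≠ j), R i

/-- The determinant of two vectors of the plane. -/
def cross (u v : Plane) : ℝ := u 0 * v 1 - u 1 * v 0

/-- Two sets are noncrossing if no segment joining points of the first outside the second meets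
a segment joining points of the second outside the first. -/
def NonCrossing (A B : Set Plane) : Prop :=
  ∀ ⦃x₁⦄, x₁ ∈ A \ B → ∀ ⦃x₂⦄, x₂ ∈ A \ B → ∀ ⦃y₁⦄, y₁ ∈ B \ A → ∀ ⦃y₂⦄, y₂ ∈ B \ A →
    Disjoint (segment ℝ x₁ x₂) (segment ℝ y₁ y₂)

lemma NonCrossing.symm {A B : Set Plane} (h : NonCrossing A B) : NonCrossing B A :=
  fun _ hx₁ _ hx₂ _ hy₁ _ hy₂ => (h hy₁ hy₂ hx₁ hx₂).symm

/-- A point on the line through `x₁ ≠ x₂` lies on the segment or is separated from every point of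
the segment by one of the endpoints. -/
lemma mem_segment_or_of_cross_eq_zero {x₁ x₂ v z : Plane} (hne : x₁ ≠ x₂)
    (hz : z ∈ segment ℝ x₁ x₂) (hv : cross (x₂ - x₁) (v - x₁) = 0) :
    v ∈ segment ℝ x₁ x₂ ∨ x₁ ∈ segment ℝ z v ∨ x₂ ∈ segment ℝ z v := by
  obtain ⟨t, rfl⟩ : ∃ t : ℝ, v = x₁ + t • (x₂ - x₁) := by
    simp only [cross, PiLp.sub_apply] at hv
    by_cases h0 : x₂ 0 - x₁ 0 = 0
    · have h1 : x₂ 1 - x₁ 1 ≠ 0 := by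
        intro h1
        apply hne
        ext i
        fin_cases i
        · simp; linarith
        · simp; linarith
      refine ⟨(v 1 - x₁ 1) / (x₂ 1 - x₁ 1), ?_⟩
      have h2 : v 0 - x₁ 0 = 0 := by
        have : (x₂ 1 - x₁ 1) * (v 0 - x₁ 0) = 0 := by rw [h0] at hv; linarith
        exact (mul_eq_zero.mp this).resolve_left h1
      ext i
      fin_cases i
      · simp [h0]; linarith
      · simp; field_simp; ring
    · refine ⟨(v 0 - x₁ 0) / (x₂ 0 - x₁ 0), ?_⟩
      ext i
      fin_cases i
      · simp; field_simp; ring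
      · simp; field_simp; linarith
  rw [segment_eq_image'] at hz
  obtain ⟨s, ⟨hs0, hs1⟩, rfl⟩ := hz
  rcases lt_or_ge t 0 with h | h
  · right; left
    have hd : 0 < s - t := by linarith
    refine ⟨-t / (s - t), s / (s - t), by apply div_nonneg <;> linarith,
      by positivity, by field_simp; ring, ?_⟩
    ext i
    simp
    field_simp
    ring
  rcases le_or_gt t 1 with h' | h'
  · left
    rw [segment_eq_image']
    exact ⟨t, ⟨h, h'⟩, rfl⟩
  · right; right
    have hd : 0 < t - s := by linarith
    refine ⟨(t - 1) / (t - s), (1 - s) / (t - s), by apply div_nonneg <;> linarith,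
      by apply div_nonneg <;> linarith, by field_simp; ring, ?_⟩
    ext i
    simp
    field_simp
    ring

/-- A line meeting one side of a triangle meets another one. -/
lemma exists_mem_segment_cross_eq_zero {e o y₁ y₂ w z : Plane}
    (hz : z ∈ segment ℝ y₁ y₂) (hz0 : cross e (z - o) = 0) :
    ∃ v, (v ∈ segment ℝ w y₁ ∨ v ∈ segment ℝ w y₂) ∧ cross e (v - o) = 0 := by
  have key : ∀ y : Plane, cross e (w - o) * cross e (y - o) ≤ 0 →
      ∃ v ∈ segment ℝ w y, cross e (v - o) = 0 := by
    intro y hy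
    have hcont : ContinuousOn (fun v : Plane => cross e (v - o)) (segment ℝ w y) := by
      unfold cross
      fun_prop
    have hconn : IsPreconnected (segment ℝ w y) := (convex_segment w y).isPreconnected
    rcases mul_nonpos_iff.mp hy with ⟨h1, h2⟩ | ⟨h1, h2⟩
    · exact hconn.intermediate_value (right_mem_segment ℝ w y) (left_mem_segment ℝ w y) hcont
        ⟨h2, h1⟩
    · exact hconn.intermediate_value (left_mem_segment ℝ w y) (right_mem_segment ℝ w y) hcont
        ⟨h1, h2⟩
  by_cases h1 : cross e (w - o) * cross e (y₁ - o) ≤ 0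
  · obtain ⟨v, hv, h⟩ := key y₁ h1
    exact ⟨v, Or.inl hv, h⟩
  by_cases h2 : cross e (w - o) * cross e (y₂ - o) ≤ 0
  · obtain ⟨v, hv, h⟩ := key y₂ h2
    exact ⟨v, Or.inr hv, h⟩
  exfalso
  push Not at h1 h2
  obtain ⟨a, b, ha, hb, hab, rfl⟩ := hz
  have : cross e (a • y₁ + b • y₂ - o) = a * cross e (y₁ - o) + b * cross e (y₂ - o) := by
    obtain rfl : b = 1 - a := by linarith
    simp [cross]
    ring
  rw [this] at hz0
  have h3 : a * (cross e (w - o) * cross e (y₁ - o)) +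
      b * (cross e (w - o) * cross e (y₂ - o)) = 0 := by
    linear_combination cross e (w - o) * hz0
  rcases ha.eq_or_lt with rfl | ha'
  · have : b = 1 := by linarith
    subst this
    linarith
  · nlinarith [mul_pos ha' h1, mul_nonneg hb h2.le]

/-- Cutting `A` with a convex set `H` can only create a crossing with `D` if all of `D` outside
`H` is in `A`. -/
lemma NonCrossing.inter_left {A D H : Set Plane} (hD : Convex ℝ D)
    (hH : Convex ℝ H) (hH' : Convex ℝ Hᶜ) (h : NonCrossing A D) (hn : ¬ D \ H ⊆ A) :
    NonCrossing (A ∩ H) D := by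
  obtain ⟨w, ⟨hwD, hwH⟩, hwA⟩ := not_subset.mp hn
  have main : ∀ x₁ ∈ (A ∩ H) \ D, ∀ x₂ ∈ (A ∩ H) \ D, ∀ y₁ ∈ D \ (A ∩ H), ∀ y₂ ∈ D \ (A ∩ H),
      ∀ z ∈ segment ℝ x₁ x₂, z ∈ segment ℝ y₁ y₂ → y₂ ∈ H → False := by
    intro x₁ hx₁ x₂ hx₂ y₁ hy₁ y₂ hy₂ z hzx hzy hyH
    have hx₁' : x₁ ∈ A \ D := ⟨hx₁.1.1, hx₁.2⟩
    have hx₂' : x₂ ∈ A \ D := ⟨hx₂.1.1, hx₂.2⟩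
    have hzD : z ∈ D := hD.segment_subset hy₁.1 hy₂.1 hzy
    have hy₂' : y₂ ∈ D \ A := ⟨hy₂.1, fun hA => hy₂.2 ⟨hA, hyH⟩⟩
    by_cases hy₁A : y₁ ∈ A
    swap
    · exact disjoint_left.mp (h hx₁' hx₂' ⟨hy₁.1, hy₁A⟩ hy₂') hzx hzy
    have hy₁H : y₁ ∈ Hᶜ := fun hH => hy₁.2 ⟨hy₁A, hH⟩
    have hne : x₁ ≠ x₂ := by
      rintro rfl
      rw [segment_same, mem_singleton_iff] at hzx
      exact hx₁.2 (hzx ▸ hzD)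
    have hz0 : cross (x₂ - x₁) (z - x₁) = 0 := by
      obtain ⟨a, b, ha, hb, hab, rfl⟩ := hzx
      obtain rfl : a = 1 - b := by linarith
      simp [cross]
      ring
    obtain ⟨v, hv, hv0⟩ := exists_mem_segment_cross_eq_zero (w := w) hzy hz0
    have hvD : v ∈ D := by
      rcases hv with hv | hv
      · exact hD.segment_subset hwD hy₁.1 hv
      · exact hD.segment_subset hwD hy₂.1 hv
    rcases mem_segment_or_of_cross_eq_zero hne hzx hv0 with hvx | hvx | hvx
    · rcases hv with hv | hv
      · exact hH'.segment_subset hwH hy₁H hv (hH.segment_subset hx₁.1.2 hx₂.1.2 hvx)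
      · exact disjoint_left.mp (h hx₁' hx₂' ⟨hwD, hwA⟩ hy₂') hvx hv
    · exact hx₁.2 (hD.segment_subset hzD hvD hvx)
    · exact hx₂.2 (hD.segment_subset hzD hvD hvx)
  intro x₁ hx₁ x₂ hx₂ y₁ hy₁ y₂ hy₂
  rw [disjoint_left]
  intro z hzx hzy
  by_cases h₂ : y₂ ∈ H
  · exact main x₁ hx₁ x₂ hx₂ y₁ hy₁ y₂ hy₂ z hzx hzy h₂
  by_cases h₁ : y₁ ∈ H
  · exact main x₁ hx₁ x₂ hx₂ y₂ hy₂ y₁ hy₁ z hzx (segment_symm ℝ y₁ y₂ ▸ hzy) h₁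
  · exact hH'.segment_subset h₁ h₂ hzy (hH.segment_subset hx₁.1.2 hx₂.1.2 hzx)

lemma NonCrossing.disjoint_convexHull_diff {A B : Set Plane} (hA : Convex ℝ A) (hB : Convex ℝ B)
    (h : NonCrossing A B) : Disjoint (convexHull ℝ (A \ B)) (convexHull ℝ (B \ A)) := by
  classical
  rw [disjoint_left]
  intro p hpA hpB
  let F : Plane →ᵃ[ℝ] Plane × ℝ := (AffineMap.id ℝ Plane).prod (AffineMap.const ℝ Plane 1)
  let W : Set (Plane × ℝ) := F '' (A \ B) ∪ (-F) '' (B \ A)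
  have h0 : (0 : Plane × ℝ) ∈ convexHull ℝ W := by
    have h1 : F p ∈ convexHull ℝ W :=
      convexHull_mono subset_union_left (F.image_convexHull (A \ B) ▸ mem_image_of_mem F hpA)
    have h2 : (-F) p ∈ convexHull ℝ W :=
      convexHull_mono subset_union_right ((-F).image_convexHull (B \ A) ▸ mem_image_of_mem (-F) hpB)
    have := (convex_convexHull ℝ W) h1 h2 (a := 1 / 2) (b := 1 / 2) (by norm_num) (by norm_num)
      (by norm_num)
    simpa using this
  obtain ⟨ι, _, u, w, hu, hind, hw, hw1, hsum⟩ := eq_pos_convex_span_of_mem_convexHull h0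
  have hcard : Fintype.card ι ≤ 4 := by
    have := hind.card_le_finrank_succ
    have h3 := Submodule.finrank_le (vectorSpan ℝ (range u))
    simp at h3
    omega
  have hu' : ∀ i, ∃ v : Plane, (v ∈ A \ B ∧ u i = (v, 1)) ∨ (v ∈ B \ A ∧ u i = (-v, -1)) := by
    intro i
    rcases hu ⟨i, rfl⟩ with ⟨v, hv, h⟩ | ⟨v, hv, h⟩
    · exact ⟨v, Or.inl ⟨hv, h.symm⟩⟩
    · exact ⟨v, Or.inr ⟨hv, h.symm⟩⟩
  choose v hv using hu'
  let P : Finset ι := Finset.univ.filter fun i => v i ∈ A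
  have hP : ∀ i ∈ P, v i ∈ A \ B ∧ u i = (v i, 1) := by
    intro i hi
    have hi : v i ∈ A := (Finset.mem_filter.mp hi).2
    exact (hv i).resolve_right fun h => h.1.2 hi
  have hQ : ∀ i ∈ Pᶜ, v i ∈ B \ A ∧ u i = (-v i, -1) := by
    intro i hi
    have hi : v i ∉ A := by simpa [P] using hi
    exact (hv i).resolve_left fun h => hi h.1.1
  have hs1 : ∑ i ∈ P, w i • v i = ∑ i ∈ Pᶜ, w i • v i := by
    have := congrArg Prod.fst hsum
    rw [Prod.fst_sum, ← Finset.sum_add_sum_compl P,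
      Finset.sum_congr rfl fun i hi => by rw [(hP i hi).2],
      Finset.sum_congr (s₁ := Pᶜ) rfl fun i hi => by rw [(hQ i hi).2]] at this
    simpa [← sub_eq_add_neg, sub_eq_zero] using this
  have hs2 : ∑ i ∈ P, w i = ∑ i ∈ Pᶜ, w i := by
    have := congrArg Prod.snd hsum
    rw [Prod.snd_sum, ← Finset.sum_add_sum_compl P,
      Finset.sum_congr rfl fun i hi => by rw [(hP i hi).2],
      Finset.sum_congr (s₁ := Pᶜ) rfl fun i hi => by rw [(hQ i hi).2]] at this
    simpa [← sub_eq_add_neg, sub_eq_zero] using this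
  have hpos : 0 < ∑ i ∈ P, w i := by
    have := Finset.sum_add_sum_compl P w
    linarith
  have hc : P.centerMass w v = Pᶜ.centerMass w v := by
    simp only [Finset.centerMass, hs1, hs2]
  have hmem : ∀ {K : Set Plane}, Convex ℝ K → (∀ i ∈ P, v i ∈ K) → P.centerMass w v ∈ K :=
    fun hK hi => hK.centerMass_mem (fun i _ => (hw i).le) hpos hi
  have hmem' : ∀ {K : Set Plane}, Convex ℝ K → (∀ i ∈ Pᶜ, v i ∈ K) → P.centerMass w v ∈ K :=
    fun hK hi => hc ▸ hK.centerMass_mem (fun i _ => (hw i).le) (hs2 ▸ hpos) hi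
  have hpA' := hmem hA fun i hi => (hP i hi).1.1
  have hpB' := hmem' hB fun i hi => (hQ i hi).1.1
  have hne : P.card ≠ 0 := by
    intro h
    simp [Finset.card_eq_zero.mp h] at hpos
  have hne' : Pᶜ.card ≠ 0 := by
    intro h
    simp [hs2, Finset.card_eq_zero.mp h] at hpos
  have hone : P.card ≠ 1 := by
    intro h
    obtain ⟨i, hi⟩ := Finset.card_eq_one.mp h
    have := hmem (convex_singleton (v i)) (by simp [hi])
    rw [mem_singleton_iff] at this
    exact (hP i (by simp [hi])).1.2 (this ▸ hpB')
  have hone' : Pᶜ.card ≠ 1 := by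
    intro h
    obtain ⟨i, hi⟩ := Finset.card_eq_one.mp h
    have := hmem' (convex_singleton (v i)) (by simp [hi])
    rw [mem_singleton_iff] at this
    exact (hQ i (by simp [hi])).1.2 (this ▸ hpA')
  have htot := Finset.card_add_card_compl P
  obtain ⟨i, j, -, hij⟩ := Finset.card_eq_two.mp (show P.card = 2 by omega)
  obtain ⟨k, l, -, hkl⟩ := Finset.card_eq_two.mp (show Pᶜ.card = 2 by omega)
  refine disjoint_left.mp (h (hP i (by simp [hij])).1 (hP j (by simp [hij])).1
    (hQ k (by simp [hkl])).1 (hQ l (by simp [hkl])).1)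
    (hmem (convex_segment _ _) ?_) (hmem' (convex_segment _ _) ?_)
  · simp [hij, left_mem_segment, right_mem_segment]
  · simp [hkl, left_mem_segment, right_mem_segment]

/-- Noncrossing convex sets are separated by a convex set with convex complement. -/
lemma NonCrossing.exists_separator {A B : Set Plane} (hA : Convex ℝ A) (hB : Convex ℝ B)
    (h : NonCrossing A B) :
    ∃ H : Set Plane, Convex ℝ H ∧ Convex ℝ Hᶜ ∧ A \ B ⊆ H ∧ B \ A ⊆ Hᶜ := by
  obtain ⟨H, hH, hH', h1, h2⟩ := exists_convex_convex_compl_subset (convex_convexHull ℝ _)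
    (convex_convexHull ℝ _) (h.disjoint_convexHull_diff hA hB)
  exact ⟨H, hH, hH', (subset_convexHull ℝ _).trans h1, (subset_convexHull ℝ _).trans h2⟩

/-- A family of pairwise noncrossing convex sets, each having a point in no other member. -/
structure IsCoverFreeNonCrossing {ι : Type*} (S : ι → Set Plane) : Prop where
  convex : ∀ i, Convex ℝ (S i)
  nonCrossing : ∀ i j, i ≠ j → NonCrossing (S i) (S j)
  exists_private : ∀ i, ∃ p ∈ S i, ∀ j, j ≠ i → p ∉ S j

/-- `T` is obtained from `S` by deleting from members points covered by other members. -/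
structure IsTrimming {ι : Type*} (S T : ι → Set Plane) : Prop where
  subset : ∀ i, T i ⊆ S i
  iUnion_eq : ⋃ i, T i = ⋃ i, S i

namespace IsTrimming

variable {ι : Type*} {S T U : ι → Set Plane}

lemma refl (S : ι → Set Plane) : IsTrimming S S := ⟨fun _ => Subset.rfl, rfl⟩

lemma trans (h : IsTrimming S T) (h' : IsTrimming T U) : IsTrimming S U :=
  ⟨fun i => (h'.subset i).trans (h.subset i), h'.iUnion_eq.trans h.iUnion_eq⟩

lemma mem_of_private (h : IsTrimming S T) {i : ι} {p : Plane} (hp : p ∈ S i)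
    (hp' : ∀ j, j ≠ i → p ∉ S j) : p ∈ T i := by
  obtain ⟨j, hj⟩ := mem_iUnion.mp (h.iUnion_eq ▸ mem_iUnion_of_mem i hp)
  by_cases hji : j = i
  · exact hji ▸ hj
  · exact absurd (h.subset j hj) (hp' j hji)

end IsTrimming

/-- One member can be cut down to one side of a separator, at the expense of another member. -/
lemma IsCoverFreeNonCrossing.exists_cut {ι : Type*} {S : ι → Set Plane}
    (hS : IsCoverFreeNonCrossing S) {a b : ι} (hab : a ≠ b) {H : Set Plane} (hH : Convex ℝ H)
    (hH' : Convex ℝ Hᶜ) (h1 : S a \ S b ⊆ H) (h2 : S b \ S a ⊆ Hᶜ) :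
    ∃ T, IsCoverFreeNonCrossing T ∧ IsTrimming S T ∧ T a = S a ∩ H ∧ T b = S b := by
  classical
  let T : ι → Set Plane := fun i => if S i \ H ⊆ S b ∧ i ≠ b then S i ∩ H else S i
  have hcut : ∀ {i}, S i \ H ⊆ S b → i ≠ b → T i = S i ∩ H := fun h h' => if_pos ⟨h, h'⟩
  have hkeep : ∀ {i}, ¬ (S i \ H ⊆ S b ∧ i ≠ b) → T i = S i := fun h => if_neg h
  have hb : T b = S b := hkeep (by simp)
  have htrim : IsTrimming S T := by
    have hsub : ∀ i, T i ⊆ S i := by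
      intro i
      by_cases h : S i \ H ⊆ S b ∧ i ≠ b
      · exact hcut h.1 h.2 ▸ inter_subset_left
      · exact (hkeep h).subset
    refine ⟨hsub, (iUnion_mono hsub).antisymm (iUnion_subset fun i x hx => ?_)⟩
    by_cases h : S i \ H ⊆ S b ∧ i ≠ b
    · by_cases hxH : x ∈ H
      · exact mem_iUnion_of_mem i (hcut h.1 h.2 ▸ ⟨hx, hxH⟩)
      · exact mem_iUnion_of_mem b (hb ▸ h.1 ⟨hx, hxH⟩)
    · exact mem_iUnion_of_mem i (hkeep h ▸ hx)
  have hmixed : ∀ i j, i ≠ j → (S i \ H ⊆ S b ∧ i ≠ b) → ¬ (S j \ H ⊆ S b ∧ j ≠ b) →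
      NonCrossing (T i) (T j) := by
    intro i j hij hi hj
    rw [hcut hi.1 hi.2, hkeep hj]
    refine (hS.nonCrossing i j hij).inter_left (hS.convex j) hH hH' fun hsub => ?_
    by_cases hjb : j = b
    · subst hjb
      obtain ⟨p, hp, hp'⟩ := hS.exists_private j
      exact hp' i hij (hsub ⟨hp, h2 ⟨hp, hp' a hab⟩⟩)
    · exact hj ⟨fun x hx => hi.1 ⟨hsub hx, hx.2⟩, hjb⟩
  refine ⟨T, ⟨fun i => ?_, fun i j hij => ?_, fun i => ?_⟩, htrim, ?_, hb⟩
  · by_cases h : S i \ H ⊆ S b ∧ i ≠ b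
    · exact hcut h.1 h.2 ▸ (hS.convex i).inter hH
    · exact hkeep h ▸ hS.convex i
  · by_cases hi : S i \ H ⊆ S b ∧ i ≠ b <;> by_cases hj : S j \ H ⊆ S b ∧ j ≠ b
    · rw [hcut hi.1 hi.2, hcut hj.1 hj.2]
      intro x₁ hx₁ x₂ hx₂ y₁ hy₁ y₂ hy₂
      exact hS.nonCrossing i j hij ⟨hx₁.1.1, fun h => hx₁.2 ⟨h, hx₁.1.2⟩⟩
        ⟨hx₂.1.1, fun h => hx₂.2 ⟨h, hx₂.1.2⟩⟩ ⟨hy₁.1.1, fun h => hy₁.2 ⟨h, hy₁.1.2⟩⟩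
        ⟨hy₂.1.1, fun h => hy₂.2 ⟨h, hy₂.1.2⟩⟩
    · exact hmixed i j hij hi hj
    · exact (hmixed j i hij.symm hj hi).symm
    · rw [hkeep hi, hkeep hj]
      exact hS.nonCrossing i j hij
  · obtain ⟨p, hp, hp'⟩ := hS.exists_private i
    exact ⟨p, htrim.mem_of_private hp hp', fun j hj hpj => hp' j hj (htrim.subset j hpj)⟩
  · have ha : S a \ H ⊆ S b := fun x hx => by_contra fun h => hx.2 (h1 ⟨hx.1, h⟩)
    exact hcut ha hab

lemma IsCoverFreeNonCrossing.exists_disjoint_pair {ι : Type*} {S : ι → Set Plane}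
    (hS : IsCoverFreeNonCrossing S) {a b : ι} (hab : a ≠ b) :
    ∃ T, IsCoverFreeNonCrossing T ∧ IsTrimming S T ∧ Disjoint (T a) (T b) := by
  obtain ⟨H, hH, hH', h1, h2⟩ :=
    (hS.nonCrossing a b hab).exists_separator (hS.convex a) (hS.convex b)
  obtain ⟨T, hT, hST, hTa, hTb⟩ := hS.exists_cut hab hH hH' h1 h2
  have h3 : T b \ T a ⊆ Hᶜ := by
    intro x hx hxH
    rw [hTb] at hx
    have hxa : x ∈ S a := by_contra fun h => h2 ⟨hx.1, h⟩ hxH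
    exact hx.2 (hTa ▸ ⟨hxa, hxH⟩)
  obtain ⟨U, hU, hTU, hUb, hUa⟩ := hT.exists_cut hab.symm hH' ((compl_compl H).symm ▸ hH)
    h3 (by rw [compl_compl]; exact sdiff_subset.trans (hTa ▸ inter_subset_right))
  exact ⟨U, hU, hST.trans hTU, disjoint_left.mpr fun x hxa hxb => (hUb ▸ hxb).2 (hTa ▸ hUa ▸ hxa : x ∈ S a ∩ H).2⟩

/-- A finite cover-free family of pairwise noncrossing convex sets can be trimmed to a family of
pairwise disjoint convex sets. -/
lemma IsCoverFreeNonCrossing.exists_pairwise_disjoint {ι : Type*} [Finite ι] {S : ι → Set Plane}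
    (hS : IsCoverFreeNonCrossing S) :
    ∃ T, IsCoverFreeNonCrossing T ∧ IsTrimming S T ∧ ∀ i j, i ≠ j → Disjoint (T i) (T j) := by
  classical
  have := Fintype.ofFinite ι
  suffices h : ∀ s : Finset (ι × ι), ∃ T, IsCoverFreeNonCrossing T ∧ IsTrimming S T ∧
      ∀ q ∈ s, q.1 ≠ q.2 → Disjoint (T q.1) (T q.2) by
    obtain ⟨T, hT, hST, hd⟩ := h Finset.univ
    exact ⟨T, hT, hST, fun i j hij => hd (i, j) (Finset.mem_univ _) hij⟩
  intro s
  induction s using Finset.induction_on with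
  | empty => exact ⟨S, hS, IsTrimming.refl S, by simp⟩
  | insert q s _ ih =>
    obtain ⟨T, hT, hST, hd⟩ := ih
    by_cases hq : q.1 = q.2
    · refine ⟨T, hT, hST, fun r hr hne => ?_⟩
      rcases Finset.mem_insert.mp hr with rfl | hr
      · exact absurd hq hne
      · exact hd r hr hne
    · obtain ⟨U, hU, hTU, hdU⟩ := hT.exists_disjoint_pair hq
      refine ⟨U, hU, hST.trans hTU, fun r hr hne => ?_⟩
      rcases Finset.mem_insert.mp hr with rfl | hr
      · exact hdU
      · exact (hd r hr hne).mono (hTU.subset _) (hTU.subset _)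

/-- In every sector between a point of `X` outside `Y` and a point of `Y` outside `X`, seen from a
common interior point, the two frontiers meet. -/
lemma exists_frontier_mem_sector {X Y : Set Plane} (hXb : Bornology.IsBounded X)
    (hX : Convex ℝ X) (hY : Convex ℝ Y) (hXc : IsClosed X) (hYc : IsClosed Y)
    (hX0 : X ∈ nhds 0) (hY0 : Y ∈ nhds 0) {x y : Plane} (hx : x ∈ X \ Y) (hy : y ∈ Y \ X)
    (hxy : cross x y ≠ 0) :
    ∃ a b : ℝ, 0 < a ∧ 0 < b ∧ a • x + b • y ∈ frontier X ∩ frontier Y := by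
  have hgx : gauge X x < gauge Y x := by
    have h1 := gauge_le_one_of_mem hx.1
    have h2 : ¬ gauge Y x ≤ 1 := by
      rw [gauge_le_one_iff_mem_closure hY hY0, hYc.closure_eq]
      exact hx.2
    linarith
  have hgy : gauge Y y < gauge X y := by
    have h1 := gauge_le_one_of_mem hy.1
    have h2 : ¬ gauge X y ≤ 1 := by
      rw [gauge_le_one_iff_mem_closure hX hX0, hXc.closure_eq]
      exact hy.2
    linarith
  have hcont : ContinuousOn (fun v => gauge X v - gauge Y v) (segment ℝ x y) :=
    ((continuous_gauge hX hX0).sub (continuous_gauge hY hY0)).continuousOn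
  obtain ⟨v, hv, hv0⟩ := (convex_segment x y).isPreconnected.intermediate_value
    (left_mem_segment ℝ x y) (right_mem_segment ℝ x y) hcont
    (show (0 : ℝ) ∈ _ from ⟨by linarith, by linarith⟩)
  have hv0 : gauge X v = gauge Y v := by simpa [sub_eq_zero] using hv0
  obtain ⟨a, b, ha, hb, hab, rfl⟩ := hv
  have ha' : 0 < a := by
    rcases ha.eq_or_lt with rfl | h
    · obtain rfl : b = 1 := by linarith
      simp at hv0
      linarith
    · exact h
  have hb' : 0 < b := by
    rcases hb.eq_or_lt with rfl | h
    · obtain rfl : a = 1 := by linarith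
      simp at hv0
      linarith
    · exact h
  set v := a • x + b • y with hv
  have hvne : v ≠ 0 := by
    intro h
    have : cross x v = b * cross x y := by simp [cross, hv]; ring
    rw [h] at this
    have h0 : cross x 0 = 0 := by simp [cross]
    rw [h0] at this
    exact mul_ne_zero hb'.ne' hxy this.symm
  have hpos : 0 < gauge X v := (gauge_pos (absorbent_nhds_zero hX0)
    (NormedSpace.isVonNBounded_of_isBounded ℝ hXb)).mpr hvne
  refine ⟨(gauge X v)⁻¹ * a, (gauge X v)⁻¹ * b, by positivity, by positivity, ?_⟩
  rw [mul_smul, mul_smul, ← smul_add, ← hv]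
  constructor
  · rw [← gauge_eq_one_iff_mem_frontier hX hX0, gauge_smul_of_nonneg (by positivity), smul_eq_mul,
      inv_mul_cancel₀ hpos.ne']
  · rw [← gauge_eq_one_iff_mem_frontier hY hY0, gauge_smul_of_nonneg (by positivity), smul_eq_mul,
      ← hv0, inv_mul_cancel₀ (ne_of_gt hpos)]

/-- The frontiers of two convex bodies that cross at the interior point `0` have more than two
common points. -/
lemma not_frontier_inter_subset_pair_of_zero {X Y : Set Plane} (hXb : IsCompact X)
    (hYb : IsCompact Y) (hX : Convex ℝ X) (hY : Convex ℝ Y)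
    (hX0 : X ∈ nhds 0) (hY0 : Y ∈ nhds 0) {x₁ x₂ y₁ y₂ : Plane}
    (hx₁ : x₁ ∈ X \ Y) (hx₂ : x₂ ∈ X \ Y) (hy₁ : y₁ ∈ Y \ X) (hy₂ : y₂ ∈ Y \ X)
    (hxy : cross x₁ y₁ ≠ 0) (hx : 0 ∈ segment ℝ x₁ x₂) (hy : 0 ∈ segment ℝ y₁ y₂) (p q : Plane) :
    ¬ frontier X ∩ frontier Y ⊆ {p, q} := by
  intro hsub
  have key : ∀ {u w : Plane} {K : Set Plane}, (0 : Plane) ∈ K → w ∉ K → 0 ∈ segment ℝ u w → u ∉ K →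
      ∃ c : ℝ, 0 < c ∧ w = -(c • u) := by
    rintro u w K h0 hw ⟨a, b, ha, hb, hab, h⟩ hu
    have hb' : b ≠ 0 := by
      rintro rfl
      obtain rfl : a = 1 := by linarith
      simp at h
      exact hu (h ▸ h0)
    have ha' : a ≠ 0 := by
      rintro rfl
      obtain rfl : b = 1 := by linarith
      simp at h
      exact hw (h ▸ h0)
    have hb'' := lt_of_le_of_ne hb hb'.symm
    have ha'' := lt_of_le_of_ne ha ha'.symm
    refine ⟨a / b, by positivity, ?_⟩
    have h2 : b • w = -(a • u) := (neg_eq_of_add_eq_zero_right h).symm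
    rw [← inv_smul_smul₀ hb' w, h2, smul_neg, smul_smul]
    congr 2
    ring
  obtain ⟨c, hc, rfl⟩ := key (mem_of_mem_nhds hY0) hx₂.2 hx hx₁.2
  obtain ⟨d, hd, rfl⟩ := key (mem_of_mem_nhds hX0) hy₂.2 hy hy₁.2
  have e1 : cross x₁ (-(d • y₁)) = -(d * cross x₁ y₁) := by simp [cross]; ring
  have e2 : cross (-(c • x₁)) y₁ = -(c * cross x₁ y₁) := by simp [cross]; ring
  have sector := fun {x y : Plane} (hx : x ∈ X \ Y) (hy : y ∈ Y \ X) =>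
    exists_frontier_mem_sector hXb.isBounded hX hY hXb.isClosed hYb.isClosed hX0 hY0 hx hy
  obtain ⟨a₁, b₁, ha₁, hb₁, h₁⟩ := sector hx₁ hy₁ hxy
  obtain ⟨a₂, b₂, ha₂, hb₂, h₂⟩ := sector hx₁ hy₂ (by rw [e1]; simp [hxy, hd.ne'])
  obtain ⟨a₃, b₃, ha₃, hb₃, h₃⟩ := sector hx₂ hy₁ (by rw [e2]; simp [hxy, hc.ne'])
  have coord : ∀ {s t s' t' : ℝ}, s • x₁ + t • y₁ = s' • x₁ + t' • y₁ → s = s' ∧ t = t' := by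
    intro s t s' t' h
    have h1 : t * cross x₁ y₁ = t' * cross x₁ y₁ := by
      have := congrArg (cross x₁) h
      simp [cross] at this
      simp only [cross]
      linarith
    have h2 : s * cross x₁ y₁ = s' * cross x₁ y₁ := by
      have := congrArg (fun v => cross v y₁) h
      simp [cross] at this
      simp only [cross]
      linarith
    exact ⟨mul_right_cancel₀ hxy h2, mul_right_cancel₀ hxy h1⟩
  have f2 : a₂ • x₁ + b₂ • -(d • y₁) = a₂ • x₁ + (-(b₂ * d)) • y₁ := by
    rw [smul_neg, neg_smul, mul_smul]
  have f3 : a₃ • -(c • x₁) + b₃ • y₁ = (-(a₃ * c)) • x₁ + b₃ • y₁ := by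
    rw [smul_neg, neg_smul, mul_smul]
  rw [f2] at h₂
  rw [f3] at h₃
  have n12 : a₁ • x₁ + b₁ • y₁ ≠ a₂ • x₁ + (-(b₂ * d)) • y₁ := by
    intro h
    have := (coord h).2
    nlinarith [mul_pos hb₂ hd]
  have n13 : a₁ • x₁ + b₁ • y₁ ≠ (-(a₃ * c)) • x₁ + b₃ • y₁ := by
    intro h
    have := (coord h).1
    nlinarith [mul_pos ha₃ hc]
  have n23 : a₂ • x₁ + (-(b₂ * d)) • y₁ ≠ (-(a₃ * c)) • x₁ + b₃ • y₁ := by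
    intro h
    have := (coord h).1
    nlinarith [mul_pos ha₃ hc]
  have g₁ := hsub h₁
  have g₂ := hsub h₂
  have g₃ := hsub h₃
  simp only [mem_insert_iff, mem_singleton_iff] at g₁ g₂ g₃
  grind

lemma not_frontier_inter_subset_pair {X Y : Set Plane} (hXb : IsCompact X)
    (hYb : IsCompact Y) (hX : Convex ℝ X) (hY : Convex ℝ Y) {z x₁ x₂ y₁ y₂ : Plane}
    (hXz : X ∈ nhds z) (hYz : Y ∈ nhds z)
    (hx₁ : x₁ ∈ X \ Y) (hx₂ : x₂ ∈ X \ Y) (hy₁ : y₁ ∈ Y \ X) (hy₂ : y₂ ∈ Y \ X)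
    (hxy : cross (x₁ - z) (y₁ - z) ≠ 0) (hx : z ∈ segment ℝ x₁ x₂) (hy : z ∈ segment ℝ y₁ y₂)
    (p q : Plane) : ¬ frontier X ∩ frontier Y ⊆ {p, q} := by
  intro hsub
  let e : Plane ≃ₜ Plane := Homeomorph.addRight z
  have hnhds : ∀ {K : Set Plane}, K ∈ nhds z → e ⁻¹' K ∈ nhds 0 := by
    intro K hK
    exact e.continuous.continuousAt.preimage_mem_nhds (by simpa [e] using hK)
  have hconv : ∀ {K : Set Plane}, Convex ℝ K → Convex ℝ (e ⁻¹' K) :=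
    fun hK => hK.translate_preimage_left z
  have hseg : ∀ {u w : Plane}, z ∈ segment ℝ u w → 0 ∈ segment ℝ (u - z) (w - z) := by
    intro u w h
    simpa [sub_eq_neg_add] using (mem_segment_translate ℝ (-z)).mpr h
  refine not_frontier_inter_subset_pair_of_zero (e.isCompact_preimage.mpr hXb)
    (e.isCompact_preimage.mpr hYb) (hconv hX) (hconv hY) (hnhds hXz) (hnhds hYz)
    (x₁ := x₁ - z) (x₂ := x₂ - z) (y₁ := y₁ - z) (y₂ := y₂ - z)
    (by simpa [e] using hx₁) (by simpa [e] using hx₂) (by simpa [e] using hy₁)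
    (by simpa [e] using hy₂) hxy (hseg hx) (hseg hy) (p - z) (q - z) ?_
  rw [← e.preimage_frontier, ← e.preimage_frontier]
  rintro v ⟨hv, hv'⟩
  rcases hsub ⟨hv, hv'⟩ with h | h
  · left; exact eq_sub_of_add_eq h
  · right; exact eq_sub_of_add_eq h

/-- If `z` is a common point on a segment joining points of `X` outside `Y`, then no point of `Y`
outside `X` is seen from `z` in the direction of that segment. -/
lemma cross_sub_sub_ne_zero {X Y : Set Plane} (hX : Convex ℝ X) (hY : Convex ℝ Y)
    {x₁ x₂ y₁ z : Plane} (hx₁ : x₁ ∈ X \ Y) (hx₂ : x₂ ∈ X \ Y) (hy₁ : y₁ ∈ Y \ X)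
    (hzx : z ∈ segment ℝ x₁ x₂) (hzX : z ∈ X) (hzY : z ∈ Y) :
    cross (x₂ - x₁) (y₁ - z) ≠ 0 := by
  intro h0
  have hne : x₁ ≠ x₂ := by
    rintro rfl
    rw [segment_same, mem_singleton_iff] at hzx
    exact hx₁.2 (hzx ▸ hzY)
  have h1 : cross (x₂ - x₁) (y₁ - x₁) = 0 := by
    obtain ⟨a, b, ha, hb, hab, rfl⟩ := hzx
    obtain rfl : a = 1 - b := by linarith
    simp [cross] at h0 ⊢
    linarith
  rcases mem_segment_or_of_cross_eq_zero hne hzx h1 with h | h | h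
  · exact hy₁.2 (hX.segment_subset hx₁.1 hx₂.1 h)
  · exact hx₁.2 (hY.segment_subset hzY hy₁.1 h)
  · exact hx₂.2 (hY.segment_subset hzY hy₁.1 h)

/-- Transversal crossing of two segments persists when endpoints are perturbed. -/
lemma eventually_segments_meet {x₁ x₂ y₁ y₂ z : Plane} (hx : z ∈ openSegment ℝ x₁ x₂)
    (hy : z ∈ openSegment ℝ y₁ y₂) (hc : cross (x₂ - x₁) (y₂ - y₁) ≠ 0) :
    ∀ᶠ v : Plane × Plane in nhds (x₁, y₁), ∃ w,
      w ∈ openSegment ℝ v.1 x₂ ∧ w ∈ openSegment ℝ v.2 y₂ := by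
  let D : Plane × Plane → ℝ := fun v => cross (x₂ - v.1) (y₂ - v.2)
  let s : Plane × Plane → ℝ := fun v => cross (v.2 - v.1) (y₂ - v.2) / D v
  let t : Plane × Plane → ℝ := fun v => cross (v.2 - v.1) (x₂ - v.1) / D v
  have hD : Continuous D := by unfold D cross; fun_prop
  have hs : ContinuousAt s (x₁, y₁) := by
    refine ContinuousAt.div (Continuous.continuousAt ?_) hD.continuousAt hc
    unfold cross; fun_prop
  have ht : ContinuousAt t (x₁, y₁) := by
    refine ContinuousAt.div (Continuous.continuousAt ?_) hD.continuousAt hc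
    unfold cross; fun_prop
  rw [openSegment_eq_image'] at hx hy
  obtain ⟨s₀, hs₀, rfl⟩ := hx
  obtain ⟨t₀, ht₀, hz⟩ := hy
  have hz0 : y₁ 0 + t₀ * (y₂ 0 - y₁ 0) = x₁ 0 + s₀ * (x₂ 0 - x₁ 0) := by
    simpa using congrArg (fun v : Plane => v 0) hz
  have hz1 : y₁ 1 + t₀ * (y₂ 1 - y₁ 1) = x₁ 1 + s₀ * (x₂ 1 - x₁ 1) := by
    simpa using congrArg (fun v : Plane => v 1) hz
  have hs1 : s (x₁, y₁) = s₀ := by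
    simp only [s, D]
    rw [div_eq_iff hc]
    simp only [cross, PiLp.sub_apply]
    linear_combination (y₂ 1 - y₁ 1) * hz0 - (y₂ 0 - y₁ 0) * hz1
  have ht1 : t (x₁, y₁) = t₀ := by
    simp only [t, D]
    rw [div_eq_iff hc]
    simp only [cross, PiLp.sub_apply]
    linear_combination (x₂ 1 - x₁ 1) * hz0 - (x₂ 0 - x₁ 0) * hz1
  filter_upwards [hD.continuousAt.eventually_ne hc,
    hs.eventually (isOpen_Ioo.mem_nhds (hs1.symm ▸ hs₀)),
    ht.eventually (isOpen_Ioo.mem_nhds (ht1.symm ▸ ht₀))] with v hv hvs hvt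
  rw [openSegment_eq_image', openSegment_eq_image']
  refine ⟨v.1 + s v • (x₂ - v.1), ⟨s v, hvs, rfl⟩, t v, hvt, ?_⟩
  have hv' : cross (x₂ - v.1) (y₂ - v.2) ≠ 0 := hv
  have hsv : s v = cross (v.2 - v.1) (y₂ - v.2) / cross (x₂ - v.1) (y₂ - v.2) := rfl
  have htv : t v = cross (v.2 - v.1) (x₂ - v.1) / cross (x₂ - v.1) (y₂ - v.2) := rfl
  ext i
  simp only [PiLp.add_apply, PiLp.smul_apply, PiLp.sub_apply, smul_eq_mul, hsv, htv]
  field_simp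
  fin_cases i <;> simp [cross] <;> ring

lemma mem_openSegment_of_mem_segment {u w z : Plane} {K : Set Plane} (h : z ∈ segment ℝ u w)
    (hz : z ∈ K) (hu : u ∉ K) (hw : w ∉ K) : z ∈ openSegment ℝ u w :=
  mem_openSegment_of_ne_left_right (fun h => hu (h ▸ hz)) (fun h => hw (h ▸ hz)) h

/-- Convex bodies whose frontiers share at most two points are noncrossing. -/
lemma IsConvexBody.nonCrossing {X Y : Set Plane} (hX : IsConvexBody X) (hY : IsConvexBody Y)
    {p q : Plane} (hpq : frontier X ∩ frontier Y ⊆ {p, q}) : NonCrossing X Y := by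
  obtain ⟨hXb, hXc, hXi⟩ := hX
  obtain ⟨hYb, hYc, hYi⟩ := hY
  intro x₁ hx₁ x₂ hx₂ y₁ hy₁ y₂ hy₂
  rw [disjoint_left]
  intro z hzx hzy
  have hzX := hXc.segment_subset hx₁.1 hx₂.1 hzx
  have hzY := hYc.segment_subset hy₁.1 hy₂.1 hzy
  have htrans : cross (x₂ - x₁) (y₂ - y₁) ≠ 0 := by
    have h := cross_sub_sub_ne_zero hXc hYc hx₁ hx₂ hy₁ hzx hzX hzY
    intro h0
    obtain ⟨a, b, ha, hb, hab, rfl⟩ := hzy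
    obtain rfl : a = 1 - b := by linarith
    apply h
    simp [cross] at h0 ⊢
    linear_combination (-b) * h0
  have hmeet := eventually_segments_meet (mem_openSegment_of_mem_segment hzx hzY hx₁.2 hx₂.2)
    (mem_openSegment_of_mem_segment hzy hzX hy₁.2 hy₂.2) htrans
  have hout : ∀ᶠ v : Plane × Plane in nhds (x₁, y₁), v.1 ∉ Y ∧ v.2 ∉ X :=
    (hYb.isClosed.isOpen_compl.prod hXb.isClosed.isOpen_compl).mem_nhds ⟨hx₁.2, hy₁.2⟩
  have hcl : (x₁, y₁) ∈ closure (interior X ×ˢ interior Y) := by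
    rw [closure_prod_eq, hXc.closure_interior_eq_closure_of_nonempty_interior hXi,
      hYc.closure_interior_eq_closure_of_nonempty_interior hYi]
    exact ⟨subset_closure hx₁.1, subset_closure hy₁.1⟩
  obtain ⟨⟨u, v⟩, ⟨hu, hv⟩, ⟨w, hwx, hwy⟩, huY, hvX⟩ :=
    ((mem_closure_iff_frequently.mp hcl).and_eventually (hmeet.and hout)).exists
  have hu' : u ∈ X \ Y := ⟨interior_subset hu, huY⟩
  have hv' : v ∈ Y \ X := ⟨interior_subset hv, hvX⟩
  have hwX := hXc.openSegment_interior_self_subset_interior hu hx₂.1 hwx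
  have hwY := hYc.openSegment_interior_self_subset_interior hv hy₂.1 hwy
  have hwx' := openSegment_subset_segment ℝ _ _ hwx
  have hwy' := openSegment_subset_segment ℝ _ _ hwy
  refine not_frontier_inter_subset_pair hXb hYb hXc hYc (mem_interior_iff_mem_nhds.mp hwX)
    (mem_interior_iff_mem_nhds.mp hwY) hu' hx₂ hv' hy₂ ?_ hwx' hwy' p q hpq
  have h := cross_sub_sub_ne_zero hXc hYc hu' hx₂ hv' hwx' (interior_subset hwX)
    (interior_subset hwY)
  intro h0
  apply h
  obtain ⟨a, ha, rfl⟩ := (openSegment_eq_image' ℝ u x₂ ▸ hwx :)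
  have h1 : a * cross (x₂ - u) (v - (u + a • (x₂ - u))) = 0 := by
    simp only [cross, PiLp.sub_apply, PiLp.add_apply, PiLp.smul_apply, smul_eq_mul] at h0 ⊢
    linear_combination -h0
  exact (mul_eq_zero.mp h1).resolve_left ha.1.ne'

theorem disjoint_union_decomposition_pseudodisks
    (n : ℕ) (R : Fin n → Set Plane)
    (hbody : ∀ i, IsConvexBody (R i))
    (hpseudo : ∀ i j : Fin n, R i ≠ R j →
      ∃ p q : Plane, frontier (R i) ∩ frontier (R j) ⊆ {p, q})
    (hcf : ∀ j, (CFidx R j).Nonempty) :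
    ∃ Rt : Fin n → Set Plane,
      (∀ j, Rt j ⊆ R j) ∧
      (∀ j, Convex ℝ (Rt j)) ∧
      (∀ i j, i ≠ j → interior (Rt i) ∩ interior (Rt j) = ∅) ∧
      (⋃ j, Rt j) = (⋃ j, R j) ∧
      (∀ j, CFidx R j ⊆ Rt j) := by
  have hprivate : ∀ {j p}, p ∈ CFidx R j → ∀ i, i ≠ j → p ∉ R i :=
    fun hp i hi hpi => hp.2 (mem_iUnion₂.mpr ⟨i, hi, hpi⟩)
  have hR : IsCoverFreeNonCrossing R := by
    refine ⟨fun i => (hbody i).2.1, fun i j hij => ?_, fun i => ?_⟩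
    · have hne : R i ≠ R j := by
        intro h
        obtain ⟨p, hp⟩ := hcf i
        exact hprivate hp j hij.symm (h ▸ hp.1)
      obtain ⟨p, q, hpq⟩ := hpseudo i j hne
      exact (hbody i).nonCrossing (hbody j) hpq
    · obtain ⟨p, hp⟩ := hcf i
      exact ⟨p, hp.1, hprivate hp⟩
  obtain ⟨T, hT, hRT, hd⟩ := hR.exists_pairwise_disjoint
  refine ⟨T, hRT.subset, hT.convex, fun i j hij => ?_, hRT.iUnion_eq,
    fun j p hp => hRT.mem_of_private hp.1 (hprivate hp)⟩
  exact ((hd i j hij).mono interior_subset interior_subset).inter_eq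
end

section
/- Let U and V be convex bodies in ℝ² whose boundaries cross exactly twice, i.e., frontier U ∩ frontier V consists of exactly two points, and assume U \ V ≠ ∅ and V \ U ≠ ∅. Let U⁰ ⊆ U and V⁰ ⊆ V be convex bodies with interior(U⁰) ∩ interior(V⁰) ≠ ∅, U⁰ \ V ≠ ∅, and V⁰ \ U ≠ ∅. Then there exist a nonzero linear functional f on ℝ², a real number c, and two distinct points p, q ∈ frontier(U⁰) ∩ frontier(V⁰) with f(p) = f(q) = c, such that U⁰ \ V ⊆ {x : f(x) ≤ c} and V⁰ \ U ⊆ {x : f(x) ≥ c}. Consequently, setting U' := U⁰ ∩ {x : f(x) ≤ c} and V' := V⁰ ∩ {x : f(x) ≥ c}, the sets U' and V' are convex with disjoint interiors, U⁰ \ V ⊆ U', V⁰ \ U ⊆ V', U⁰ \ U' ⊆ V, and V⁰ \ V' ⊆ U. -/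
open Set

theorem sign_const_of_ne_zero {g : ℝ → ℝ} (hg : Continuous g) {a b : ℝ}
    (h : ∀ θ ∈ Ioo a b, g θ ≠ 0) :
    (∀ θ ∈ Ioo a b, g θ < 0) ∨ (∀ θ ∈ Ioo a b, 0 < g θ) := by
  by_contra! hcon
  obtain ⟨⟨x, hx, hx0⟩, y, hy, hy0⟩ := hcon
  obtain ⟨z, hz, hz0⟩ :=
    isPreconnected_Ioo.intermediate_value hy hx hg.continuousOn ⟨hy0, hx0⟩
  exact h z hz hz0

/-- A continuous function on a loop with exactly two zeros and both signs is nonpositive on one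
of the two arcs and nonnegative on the other one. -/
theorem exists_sign_arcs {X : Type*} [TopologicalSpace X] {e : ℝ → X} {T : ℝ} (hT : 0 < T)
    (he : Continuous e) (hp : Function.Periodic e T) (hinj : ∀ a, InjOn e (Ico a (a + T)))
    {h : X → ℝ} (hc : Continuous h) {a b : ℝ} (ha : h (e a) = 0) (hb : h (e b) = 0)
    (hab : e a ≠ e b) (hz : ∀ θ, h (e θ) = 0 → e θ = e a ∨ e θ = e b)
    (hneg : ∃ θ, h (e θ) < 0) (hpos : ∃ θ, 0 < h (e θ)) :
    ∃ s t, s ≤ t ∧ t ≤ s + T ∧ (∀ θ ∈ Icc s t, h (e θ) ≤ 0) ∧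
      ∀ θ ∈ Icc t (s + T), 0 ≤ h (e θ) := by
  obtain ⟨t, ⟨hat, htT⟩, hbt⟩ := hp.exists_mem_Ico hT b a
  rw [hbt] at hb hab hz
  have hat' : a < t := lt_of_le_of_ne hat fun hh => hab (by rw [hh])
  have haT : h (e (a + T)) = 0 := by rw [hp]; exact ha
  have key : ∀ θ, a < θ → θ < a + T → θ ≠ t → h (e θ) ≠ 0 := by
    intro θ h1 h2 h3 h0
    rcases hz θ h0 with h4 | h4
    · exact h1.ne' (hinj a ⟨h1.le, h2⟩ ⟨le_rfl, by linarith⟩ h4)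
    · exact h3 (hinj a ⟨h1.le, h2⟩ ⟨hat, htT⟩ h4)
  have hcl : ∀ (P : ℝ → Prop) (x y : ℝ), P 0 → h (e x) = 0 → h (e y) = 0 →
      (∀ θ ∈ Ioo x y, P (h (e θ))) → ∀ θ ∈ Icc x y, P (h (e θ)) := by
    intro P x y h0 hx hy hP θ hθ
    rcases hθ.1.eq_or_lt with rfl | h1
    · rwa [hx]
    rcases hθ.2.eq_or_lt with rfl | h2
    · rwa [hy]
    exact hP θ ⟨h1, h2⟩
  have hrep : ∀ θ, ∃ θ', (θ' ∈ Icc a t ∨ θ' ∈ Icc t (a + T)) ∧ e θ = e θ' := by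
    intro θ
    obtain ⟨θ', ⟨h1, h2⟩, h3⟩ := hp.exists_mem_Ico hT θ a
    refine ⟨θ', ?_, h3⟩
    rcases le_total θ' t with h4 | h4
    · exact .inl ⟨h1, h4⟩
    · exact .inr ⟨h4, h2.le⟩
  have hce : Continuous fun θ => h (e θ) := hc.comp he
  rcases sign_const_of_ne_zero hce (a := a) (b := t)
      (fun θ hθ => key θ hθ.1 (hθ.2.trans htT) hθ.2.ne) with h1 | h1 <;>
    rcases sign_const_of_ne_zero hce (a := t) (b := a + T)
      (fun θ hθ => key θ (hat'.trans hθ.1) hθ.2 hθ.1.ne') with h2 | h2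
  · have h1' := hcl (· ≤ 0) a t le_rfl ha hb fun θ hθ => (h1 θ hθ).le
    have h2' := hcl (· ≤ 0) t (a + T) le_rfl hb haT fun θ hθ => (h2 θ hθ).le
    obtain ⟨θ, hθ⟩ := hpos
    obtain ⟨θ', h3 | h3, h4⟩ := hrep θ <;> rw [h4] at hθ
    · exact absurd (h1' θ' h3) hθ.not_ge
    · exact absurd (h2' θ' h3) hθ.not_ge
  · exact ⟨a, t, hat, htT.le, hcl (· ≤ 0) a t le_rfl ha hb fun θ hθ => (h1 θ hθ).le,
      hcl (0 ≤ ·) t (a + T) le_rfl hb haT fun θ hθ => (h2 θ hθ).le⟩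
  · refine ⟨t, a + T, htT.le, by linarith,
      hcl (· ≤ 0) t (a + T) le_rfl hb haT fun θ hθ => (h2 θ hθ).le, ?_⟩
    have h1' := hcl (0 ≤ ·) a t le_rfl ha hb fun θ hθ => (h1 θ hθ).le
    intro θ hθ
    have := h1' (θ - T) ⟨by linarith [hθ.1], by linarith [hθ.2]⟩
    rwa [hp.sub_eq] at this
  · have h1' := hcl (0 ≤ ·) a t le_rfl ha hb fun θ hθ => (h1 θ hθ).le
    have h2' := hcl (0 ≤ ·) t (a + T) le_rfl hb haT fun θ hθ => (h2 θ hθ).le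
    obtain ⟨θ, hθ⟩ := hneg
    obtain ⟨θ', h3 | h3, h4⟩ := hrep θ <;> rw [h4] at hθ
    · exact absurd (h1' θ' h3) hθ.not_ge
    · exact absurd (h2' θ' h3) hθ.not_ge

/-- The extreme points of the set where `f < g` in a compact interval, together with the weak
inequality there. -/
theorem exists_extreme_of_lt {f g : ℝ → ℝ} (hf : Continuous f) (hg : Continuous g) {a b x : ℝ}
    (hx : x ∈ Icc a b) (hfg : f x < g x) :
    ∃ l r, a ≤ l ∧ l ≤ x ∧ x ≤ r ∧ r ≤ b ∧ f l ≤ g l ∧ f r ≤ g r ∧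
      ∀ y ∈ Icc a b, f y < g y → y ∈ Icc l r := by
  set D := {y | y ∈ Icc a b ∧ f y < g y} with hD
  have hxD : x ∈ D := ⟨hx, hfg⟩
  have hbb : BddBelow D := ⟨a, fun y hy => hy.1.1⟩
  have hba : BddAbove D := ⟨b, fun y hy => hy.1.2⟩
  have hcl : closure D ⊆ {y | y ∈ Icc a b ∧ f y ≤ g y} :=
    closure_minimal (fun y hy => ⟨hy.1, hy.2.le⟩) (isClosed_Icc.inter (isClosed_le hf hg))
  have hl := hcl (csInf_mem_closure ⟨x, hxD⟩ hbb)
  have hr := hcl (csSup_mem_closure ⟨x, hxD⟩ hba)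
  exact ⟨sInf D, sSup D, hl.1.1, csInf_le hbb hxD, le_csSup hba hxD, hr.1.2, hl.2, hr.2,
    fun y h1 h2 => ⟨csInf_le hbb ⟨h1, h2⟩, le_csSup hba ⟨h1, h2⟩⟩⟩

theorem exists_eq_of_le_of_le {f g : ℝ → ℝ} (hf : Continuous f) (hg : Continuous g) {a b : ℝ}
    (hab : a ≤ b) (ha : f a ≤ g a) (hb : g b ≤ f b) : ∃ x ∈ Icc a b, f x = g x := by
  obtain ⟨x, hx, h⟩ := isPreconnected_Icc.intermediate_value₂ (left_mem_Icc.2 hab)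
    (right_mem_Icc.2 hab) hf.continuousOn hg.continuousOn ha hb
  exact ⟨x, hx, h⟩

theorem exists_separating_params {X : Type*} [TopologicalSpace X] {e : ℝ → X} {T : ℝ}
    (hT : 0 < T) (he : Continuous e) (hp : Function.Periodic e T) {u v u₀ v₀ : X → ℝ}
    (hu : Continuous u) (hv : Continuous v) (hu₀ : Continuous u₀) (hv₀ : Continuous v₀)
    (huu : ∀ x, u x ≤ u₀ x) (hvv : ∀ x, v x ≤ v₀ x) {s t : ℝ}
    (h₁ : ∀ θ ∈ Icc s t, u (e θ) ≤ v (e θ)) (h₂ : ∀ θ ∈ Icc t (s + T), v (e θ) ≤ u (e θ))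
    (hU : ∃ θ, u₀ (e θ) < v (e θ)) (hV : ∃ θ, v₀ (e θ) < u (e θ)) :
    ∃ φ ψ, φ < ψ ∧ ψ < φ + T ∧ u₀ (e φ) = v₀ (e φ) ∧ u₀ (e ψ) = v₀ (e ψ) ∧
      (∀ θ, v₀ (e θ) < u (e θ) → ∃ θ' ∈ Icc φ ψ, e θ = e θ') ∧
      (∀ θ, u₀ (e θ) < v (e θ) → ∃ θ' ∈ Icc ψ (φ + T), e θ = e θ') := by
  have hUrep : ∀ θ, u₀ (e θ) < v (e θ) → ∃ θ' ∈ Icc s t, e θ = e θ' := by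
    intro θ hθ
    obtain ⟨θ', ⟨ha, hb⟩, hc⟩ := hp.exists_mem_Ico hT θ s
    refine ⟨θ', ⟨ha, ?_⟩, hc⟩
    by_contra! hlt
    rw [hc] at hθ
    linarith [h₂ θ' ⟨hlt.le, hb.le⟩, huu (e θ')]
  have hVrep : ∀ θ, v₀ (e θ) < u (e θ) → ∃ θ' ∈ Icc t (s + T), e θ = e θ' := by
    intro θ hθ
    obtain ⟨θ', ⟨ha, hb⟩, hc⟩ := hp.exists_mem_Ico hT θ s
    refine ⟨θ', ⟨?_, hb.le⟩, hc⟩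
    by_contra! hlt
    rw [hc] at hθ
    linarith [h₁ θ' ⟨ha, hlt.le⟩, hvv (e θ')]
  obtain ⟨x, hx⟩ := hU
  obtain ⟨x', hx', hxe⟩ := hUrep x hx
  rw [hxe] at hx
  obtain ⟨y, hy⟩ := hV
  obtain ⟨y', hy', hye⟩ := hVrep y hy
  rw [hye] at hy
  obtain ⟨a₁, a₂, ha₁, hax, hxa, ha₂, hfa₁, hfa₂, hA⟩ :=
    exists_extreme_of_lt (hu₀.comp he) (hv.comp he) hx' hx
  obtain ⟨b₁, b₂, hb₁, hby, hyb, hb₂, hfb₁, hfb₂, hB⟩ :=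
    exists_extreme_of_lt (hv₀.comp he) (hu.comp he) hy' hy
  simp only [Function.comp_apply] at hfa₁ hfa₂ hfb₁ hfb₂ hA hB
  obtain ⟨φ, ⟨hφ₁, hφ₂⟩, hφ⟩ := exists_eq_of_le_of_le (hu₀.comp he) (hv₀.comp he)
    (ha₂.trans hb₁) (hfa₂.trans (hvv _)) (hfb₁.trans (huu _))
  obtain ⟨ψ, ⟨hψ₁, hψ₂⟩, hψ⟩ := exists_eq_of_le_of_le (hv₀.comp he) (hu₀.comp he)
    (a := b₂) (b := a₁ + T) (by linarith) (hfb₂.trans (huu _))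
    (by simp only [Function.comp_apply, hp a₁]; exact hfa₁.trans (hvv _))
  simp only [Function.comp_apply] at hφ hψ
  have hyne : ∀ θ, u₀ (e θ) = v₀ (e θ) → θ ≠ y' := by
    rintro θ hθ rfl
    linarith [huu (e θ)]
  have hxne : ∀ θ, u₀ (e θ) = v₀ (e θ) → e θ ≠ e x' := by
    intro θ hθ h
    rw [h] at hθ
    linarith [hvv (e x')]
  have hφy : φ < y' := lt_of_le_of_ne (hφ₂.trans hby) (hyne φ hφ)
  have hxφ : x' < φ := lt_of_le_of_ne (hxa.trans hφ₁) fun h => hxne φ hφ (by rw [h])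
  refine ⟨φ, ψ, hφy.trans_le (hyb.trans hψ₁), by linarith, hφ, hψ.symm, ?_, ?_⟩
  · intro θ hθ
    obtain ⟨θ', h1, h2⟩ := hVrep θ hθ
    rw [h2] at hθ
    have := hB θ' h1 hθ
    exact ⟨θ', ⟨by linarith [this.1], by linarith [this.2]⟩, h2⟩
  · intro θ hθ
    obtain ⟨θ', h1, h2⟩ := hUrep θ hθ
    rw [h2] at hθ
    have := hA θ' h1 hθ
    exact ⟨θ' + T, ⟨by linarith [this.1], by linarith [this.2]⟩, by rw [h2, hp]⟩

/-- The unit vector with polar angle `θ`. -/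
noncomputable def unitVec (θ : ℝ) : Plane := !₂[Real.cos θ, Real.sin θ]

@[simp] theorem unitVec_zero (θ : ℝ) : unitVec θ 0 = Real.cos θ := by simp [unitVec]

@[simp] theorem unitVec_one (θ : ℝ) : unitVec θ 1 = Real.sin θ := by simp [unitVec]

theorem plane_ext {x y : Plane} (h0 : x 0 = y 0) (h1 : x 1 = y 1) : x = y := by
  ext i
  fin_cases i
  · exact h0
  · exact h1

theorem continuous_unitVec : Continuous unitVec := by
  unfold unitVec
  fun_prop

theorem unitVec_periodic : Function.Periodic unitVec (2 * Real.pi) := by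
  intro θ
  simp [unitVec]

theorem norm_unitVec (θ : ℝ) : ‖unitVec θ‖ = 1 := by
  simp [EuclideanSpace.norm_eq]

theorem exists_polar (x : Plane) : ∃ θ, x = ‖x‖ • unitVec θ := by
  refine ⟨Complex.arg ⟨x 0, x 1⟩, ?_⟩
  have hn : ‖x‖ = ‖(⟨x 0, x 1⟩ : ℂ)‖ := by
    simp [EuclideanSpace.norm_eq, Complex.norm_def, Complex.normSq, sq]
  rw [hn]
  refine plane_ext ?_ ?_
  · simp
  · simp

theorem unitVec_injOn (a : ℝ) : InjOn unitVec (Ico a (a + 2 * Real.pi)) := by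
  intro x hx y hy h
  have h0 : Real.cos x = Real.cos y := by simpa using congrArg (· 0) h
  have h1 : Real.sin x = Real.sin y := by simpa using congrArg (· 1) h
  have hc : Real.cos (x - y) = 1 := by
    rw [Real.cos_sub, h0, h1]
    nlinarith [Real.sin_sq_add_cos_sq y]
  have := (Real.cos_eq_one_iff_of_lt_of_lt (by linarith [hx.1, hy.2])
    (by linarith [hx.2, hy.1])).1 hc
  linarith

theorem eq_of_smul_unitVec_eq {a b θ φ : ℝ} (ha : 0 < a) (hb : 0 < b)
    (h : a • unitVec θ = b • unitVec φ) : unitVec θ = unitVec φ := by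
  have hn := congrArg norm h
  rw [norm_smul, norm_smul, norm_unitVec, norm_unitVec, mul_one, mul_one,
    Real.norm_of_nonneg ha.le, Real.norm_of_nonneg hb.le] at hn
  subst hn
  exact smul_right_injective _ (ne_of_gt ha) h

/-- The oriented area form of the plane. -/
def crossProd (x y : Plane) : ℝ := x 0 * y 1 - x 1 * y 0

theorem crossProd_smul_unitVec (a b θ φ : ℝ) :
    crossProd (a • unitVec θ) (b • unitVec φ) = a * b * Real.sin (φ - θ) := by
  simp only [crossProd, PiLp.smul_apply, unitVec_zero, unitVec_one, smul_eq_mul, Real.sin_sub]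
  ring

theorem crossProd_smul_eq (p q x : Plane) :
    crossProd p q • x = crossProd x q • p + crossProd p x • q := by
  refine plane_ext ?_ ?_ <;> simp [crossProd] <;> ring

theorem eq_div_smul_add_div_smul {E : Type*} [AddCommGroup E] [Module ℝ E] {a b c : ℝ}
    {x y z : E} (hc : c ≠ 0) (h : c • z = a • x + b • y) : z = (a / c) • x + (b / c) • y := by
  rw [div_eq_inv_mul, div_eq_inv_mul, mul_smul, mul_smul, ← smul_add, ← h, inv_smul_smul₀ hc]

theorem gauge_combo_le {S : Set Plane} (hS : Convex ℝ S) (h0 : S ∈ nhds 0) {a b : ℝ} (ha : 0 ≤ a)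
    (hb : 0 ≤ b) {x y : Plane} (hx : gauge S x ≤ 1) (hy : gauge S y ≤ 1) :
    gauge S (a • x + b • y) ≤ a + b := by
  refine (gauge_add_le hS (absorbent_nhds_zero h0) _ _).trans ?_
  rw [gauge_smul_of_nonneg ha, gauge_smul_of_nonneg hb, smul_eq_mul, smul_eq_mul]
  nlinarith

/-- A point in the sector from `p` to `q` that lies in `K` but not in `K'`, where `p` and `q` are
boundary points of both sets, does not lie strictly on the left of the line from `p` to `q`. -/
theorem crossProd_add_le {K K' : Set Plane} (hK : Convex ℝ K) (hK0 : K ∈ nhds 0)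
    (hK' : Convex ℝ K') (hK0' : K' ∈ nhds 0) {ρ σ r φ ψ θ : ℝ} (hρ : 0 < ρ) (hσ : 0 < σ)
    (hr : 0 < r) (hψ : ψ < φ + 2 * Real.pi) (hθ : θ ∈ Icc φ ψ)
    (hp : gauge K (ρ • unitVec φ) = 1) (hq : gauge K (σ • unitVec ψ) = 1)
    (hp' : gauge K' (ρ • unitVec φ) = 1) (hq' : gauge K' (σ • unitVec ψ) = 1)
    (hx : gauge K (r • unitVec θ) ≤ 1) (hx' : 1 < gauge K' (r • unitVec θ)) :
    crossProd (ρ • unitVec φ) (σ • unitVec ψ) ≤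
      crossProd (r • unitVec θ) (σ • unitVec ψ) + crossProd (ρ • unitVec φ) (r • unitVec θ) := by
  have hrel := crossProd_smul_eq (ρ • unitVec φ) (σ • unitVec ψ) (r • unitVec θ)
  have had := crossProd_smul_unitVec r σ θ ψ
  have hbd := crossProd_smul_unitVec ρ r φ θ
  have hdd := crossProd_smul_unitVec ρ σ φ ψ
  set p := ρ • unitVec φ
  set q := σ • unitVec ψ
  set x := r • unitVec θ
  set a := crossProd x q
  set b := crossProd p x
  set d := crossProd p q
  by_contra! hlt
  have hpi := Real.pi_pos
  have hsin : ∀ {m y : ℝ}, 0 < m → 0 ≤ y → m * Real.sin y < 0 → Real.pi < y := by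
    intro m y hm hy h
    by_contra! hle
    exact absurd (mul_nonneg hm.le (Real.sin_nonneg_of_nonneg_of_le_pi hy hle)) h.not_ge
  have hdneg : Real.pi < ψ - φ → d < 0 := by
    intro h
    rw [hdd]
    have := Real.sin_neg_of_neg_of_neg_pi_lt (x := ψ - φ - 2 * Real.pi) (by linarith)
      (by linarith)
    rw [Real.sin_sub_two_pi] at this
    exact mul_neg_of_pos_of_neg (mul_pos hρ hσ) this
  have ha' : a < 0 → Real.pi < ψ - θ := fun h =>
    hsin (mul_pos hr hσ) (by linarith [hθ.2]) (had ▸ h)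
  have hb' : b < 0 → Real.pi < θ - φ := fun h =>
    hsin (mul_pos hρ hr) (by linarith [hθ.1]) (hbd ▸ h)
  rcases lt_or_ge a 0 with ha | ha <;> rcases lt_or_ge b 0 with hb | hb
  · linarith [ha' ha, hb' hb]
  · have hd := hdneg (by linarith [ha' ha, hθ.1])
    have hpe : p = (d / a) • x + (-b / a) • q :=
      eq_div_smul_add_div_smul ha.ne (by rw [hrel]; module)
    have hle := gauge_combo_le hK hK0 (div_nonneg_of_nonpos hd.le ha.le)
      (div_nonneg_of_nonpos (neg_nonpos.2 hb) ha.le) hx hq.le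
    rw [← hpe, hp, ← add_div, le_div_iff_of_neg ha] at hle
    linarith
  · have hd := hdneg (by linarith [hb' hb, hθ.2])
    have hqe : q = (d / b) • x + (-a / b) • p :=
      eq_div_smul_add_div_smul hb.ne (by rw [hrel]; module)
    have hle := gauge_combo_le hK hK0 (div_nonneg_of_nonpos hd.le hb.le)
      (div_nonneg_of_nonpos (neg_nonpos.2 ha) hb.le) hx hp.le
    rw [← hqe, hq, ← add_div, le_div_iff_of_neg hb] at hle
    linarith
  · have hd : 0 < d := by linarith
    have hxe : x = (a / d) • p + (b / d) • q := eq_div_smul_add_div_smul hd.ne' hrel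
    have hle := gauge_combo_le hK' hK0' (div_nonneg ha hd.le) (div_nonneg hb hd.le) hp'.le hq'.le
    rw [← hxe, ← add_div] at hle
    have : (a + b) / d < 1 := (div_lt_one hd).2 hlt
    linarith

/-- The linear functional whose level lines are parallel to `w`. -/
def crossProdRight (w : Plane) : Plane →ₗ[ℝ] ℝ where
  toFun x := crossProd x w
  map_add' x y := by simp [crossProd]; ring
  map_smul' a x := by simp [crossProd]; ring

theorem crossProdRight_ne_zero {w : Plane} (hw : w ≠ 0) : crossProdRight w ≠ 0 := by
  intro h
  refine hw (plane_ext ?_ ?_)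
  · simpa [crossProdRight, crossProd] using LinearMap.congr_fun h !₂[0, 1]
  · simpa [crossProdRight, crossProd] using LinearMap.congr_fun h !₂[1, 0]

theorem mem_iff_gauge_le_one {S : Set Plane} (hS : IsConvexBody S) (h0 : S ∈ nhds 0) {x : Plane} :
    x ∈ S ↔ gauge S x ≤ 1 := by
  rw [gauge_le_one_iff_mem_closure hS.2.1 h0, hS.1.isClosed.closure_eq]

theorem gauge_pos_of_ne_zero {S : Set Plane} (hS : IsConvexBody S) (h0 : S ∈ nhds 0) {x : Plane}
    (hx : x ≠ 0) : 0 < gauge S x :=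
  (gauge_pos (absorbent_nhds_zero h0)
    ((NormedSpace.isVonNBounded_iff ℝ).2 hS.1.isBounded)).2 hx

theorem gauge_unitVec_pos {S : Set Plane} (hS : IsConvexBody S) (h0 : S ∈ nhds 0) (θ : ℝ) :
    0 < gauge S (unitVec θ) :=
  gauge_pos_of_ne_zero hS h0 fun h => by simpa [h] using norm_unitVec θ

theorem gauge_smul_unitVec {S : Set Plane} {r : ℝ} (hr : 0 ≤ r) (θ : ℝ) :
    gauge S (r • unitVec θ) = r * gauge S (unitVec θ) := by
  rw [gauge_smul_of_nonneg hr, smul_eq_mul]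

/-- A point of `A` outside `B`, in polar coordinates. -/
theorem exists_polar_of_mem_diff {A B : Set Plane} (hA : IsConvexBody A) (hA0 : A ∈ nhds 0)
    (hB : IsConvexBody B) (hB0 : B ∈ nhds 0) {x : Plane} (hx : x ∈ A \ B) :
    ∃ r θ : ℝ, 0 < r ∧ x = r • unitVec θ ∧ gauge A (unitVec θ) < gauge B (unitVec θ) := by
  obtain ⟨θ, hθ⟩ := exists_polar x
  have hx0 : x ≠ 0 := fun h => hx.2 (h ▸ mem_of_mem_nhds hB0)
  have hr : 0 < ‖x‖ := norm_pos_iff.2 hx0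
  have h1 := (mem_iff_gauge_le_one hA hA0).1 hx.1
  have h2 := not_le.1 fun h => hx.2 ((mem_iff_gauge_le_one hB hB0).2 h)
  rw [hθ, gauge_smul_unitVec hr.le] at h1 h2
  exact ⟨‖x‖, θ, hr, hθ, lt_of_mul_lt_mul_left (h1.trans_lt h2) hr.le⟩

/-- The separation statement for bodies having the origin in their interiors. -/
theorem exists_separating_chord_of_mem_nhds {U V U0 V0 : Set Plane} (hU : IsConvexBody U)
    (hV : IsConvexBody V) (hU0 : IsConvexBody U0) (hV0 : IsConvexBody V0)
    (hcross : ∃ p₁ p₂ : Plane, p₁ ≠ p₂ ∧ frontier U ∩ frontier V = {p₁, p₂})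
    (hU0U : U0 ⊆ U) (hV0V : V0 ⊆ V) (hnU : U0 ∈ nhds 0) (hnV : V0 ∈ nhds 0)
    (hU0V : (U0 \ V).Nonempty) (hV0U : (V0 \ U).Nonempty) :
    ∃ (f : Plane →ₗ[ℝ] ℝ) (c : ℝ) (p q : Plane), f ≠ 0 ∧ p ≠ q ∧
      p ∈ frontier U0 ∩ frontier V0 ∧ q ∈ frontier U0 ∩ frontier V0 ∧
      f p = c ∧ f q = c ∧ (∀ x ∈ U0 \ V, f x ≤ c) ∧ ∀ x ∈ V0 \ U, c ≤ f x := by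
  have hnU' : U ∈ nhds 0 := Filter.mem_of_superset hnU hU0U
  have hnV' : V ∈ nhds 0 := Filter.mem_of_superset hnV hV0V
  have hgU := continuous_gauge hU.2.1 hnU'
  have hgV := continuous_gauge hV.2.1 hnV'
  have hgU0 := continuous_gauge hU0.2.1 hnU
  have hgV0 := continuous_gauge hV0.2.1 hnV
  have hUU := gauge_mono (absorbent_nhds_zero hnU) hU0U
  have hVV := gauge_mono (absorbent_nhds_zero hnV) hV0V
  have hpi := Real.two_pi_pos
  have hexU : ∃ θ, gauge U0 (unitVec θ) < gauge V (unitVec θ) := by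
    obtain ⟨x, hx⟩ := hU0V
    obtain ⟨_, θ, _, _, h⟩ := exists_polar_of_mem_diff hU0 hnU hV hnV' hx
    exact ⟨θ, h⟩
  have hexV : ∃ θ, gauge V0 (unitVec θ) < gauge U (unitVec θ) := by
    obtain ⟨x, hx⟩ := hV0U
    obtain ⟨_, θ, _, _, h⟩ := exists_polar_of_mem_diff hV0 hnV hU hnU' hx
    exact ⟨θ, h⟩
  obtain ⟨s, t, hneg, hpos⟩ : ∃ s t,
      (∀ θ ∈ Icc s t, gauge U (unitVec θ) ≤ gauge V (unitVec θ)) ∧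
      ∀ θ ∈ Icc t (s + 2 * Real.pi), gauge V (unitVec θ) ≤ gauge U (unitVec θ) := by
    obtain ⟨p₁, p₂, hne, hfr⟩ := hcross
    have hmem : ∀ x, x ∈ ({p₁, p₂} : Set Plane) ↔ gauge U x = 1 ∧ gauge V x = 1 := by
      intro x
      rw [← hfr, gauge_eq_one_iff_mem_frontier hU.2.1 hnU',
        gauge_eq_one_iff_mem_frontier hV.2.1 hnV']
      rfl
    have hpolar : ∀ x, gauge U x = 1 → gauge V x = 1 → ∃ θ,
        gauge U (unitVec θ) = gauge V (unitVec θ) ∧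
        x = (gauge U (unitVec θ))⁻¹ • unitVec θ := by
      intro x h1 h2
      obtain ⟨θ, hθ⟩ := exists_polar x
      rw [hθ, gauge_smul_unitVec (norm_nonneg x)] at h1 h2
      have h3 := eq_inv_of_mul_eq_one_left h1
      refine ⟨θ, ?_, by rw [← h3]; exact hθ⟩
      rw [← inv_inj, ← h3, eq_inv_of_mul_eq_one_left h2]
    have h₁ := (hmem p₁).1 (by simp)
    have h₂ := (hmem p₂).1 (by simp)
    obtain ⟨a, ha, hpa⟩ := hpolar p₁ h₁.1 h₁.2
    obtain ⟨b, hb, hpb⟩ := hpolar p₂ h₂.1 h₂.2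
    have hzero : ∀ θ, gauge U (unitVec θ) = gauge V (unitVec θ) →
        unitVec θ = unitVec a ∨ unitVec θ = unitVec b := by
      intro θ hθ'
      have hp := gauge_unitVec_pos hU hnU' θ
      have hx : (gauge U (unitVec θ))⁻¹ • unitVec θ ∈ ({p₁, p₂} : Set Plane) := by
        rw [hmem, gauge_smul_unitVec (inv_pos.2 hp).le, gauge_smul_unitVec (inv_pos.2 hp).le,
          ← hθ', inv_mul_cancel₀ hp.ne']
        exact ⟨rfl, rfl⟩
      rcases hx with hx | hx
      · exact .inl (eq_of_smul_unitVec_eq (inv_pos.2 hp)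
          (inv_pos.2 (gauge_unitVec_pos hU hnU' a)) (hx.trans hpa))
      · exact .inr (eq_of_smul_unitVec_eq (inv_pos.2 hp)
          (inv_pos.2 (gauge_unitVec_pos hU hnU' b)) (hx.trans hpb))
    obtain ⟨s, t, -, -, h⟩ := exists_sign_arcs hpi continuous_unitVec unitVec_periodic
      unitVec_injOn (hgU.sub hgV) (a := a) (b := b) (sub_eq_zero.2 ha) (sub_eq_zero.2 hb)
      (fun h => hne (by rw [hpa, hpb, h])) (fun θ hθ => hzero θ (sub_eq_zero.1 hθ))
      (hexU.imp fun θ h => sub_neg.2 ((hUU _).trans_lt h))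
      (hexV.imp fun θ h => sub_pos.2 ((hVV _).trans_lt h))
    exact ⟨s, t, fun θ hθ => sub_nonpos.1 (h.1 θ hθ), fun θ hθ => sub_nonneg.1 (h.2 θ hθ)⟩
  obtain ⟨φ, ψ, hφψ, hψφ, hφ, hψ, hVs, hUs⟩ := exists_separating_params hpi continuous_unitVec
    unitVec_periodic hgU hgV hgU0 hgV0 hUU hVV hneg hpos hexU hexV
  have hρ := inv_pos.2 (gauge_unitVec_pos hU0 hnU φ)
  have hσ := inv_pos.2 (gauge_unitVec_pos hU0 hnU ψ)
  set ρ := (gauge U0 (unitVec φ))⁻¹ with hρd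
  set σ := (gauge U0 (unitVec ψ))⁻¹ with hσd
  have hpU : gauge U0 (ρ • unitVec φ) = 1 := by
    rw [gauge_smul_unitVec hρ.le, hρd, inv_mul_cancel₀ (gauge_unitVec_pos hU0 hnU φ).ne']
  have hqU : gauge U0 (σ • unitVec ψ) = 1 := by
    rw [gauge_smul_unitVec hσ.le, hσd, inv_mul_cancel₀ (gauge_unitVec_pos hU0 hnU ψ).ne']
  have hpV : gauge V0 (ρ • unitVec φ) = 1 := by
    rw [gauge_smul_unitVec hρ.le, ← hφ, ← gauge_smul_unitVec hρ.le, hpU]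
  have hqV : gauge V0 (σ • unitVec ψ) = 1 := by
    rw [gauge_smul_unitVec hσ.le, ← hψ, ← gauge_smul_unitVec hσ.le, hqU]
  have hpq : ρ • unitVec φ ≠ σ • unitVec ψ := fun h =>
    hφψ.ne (unitVec_injOn φ ⟨le_rfl, by linarith⟩ ⟨hφψ.le, hψφ⟩ (eq_of_smul_unitVec_eq hρ hσ h))
  refine ⟨crossProdRight (σ • unitVec ψ - ρ • unitVec φ),
    crossProd (ρ • unitVec φ) (σ • unitVec ψ), ρ • unitVec φ, σ • unitVec ψ,
    crossProdRight_ne_zero (sub_ne_zero.2 hpq.symm), hpq,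
    ⟨(gauge_eq_one_iff_mem_frontier hU0.2.1 hnU).1 hpU,
      (gauge_eq_one_iff_mem_frontier hV0.2.1 hnV).1 hpV⟩,
    ⟨(gauge_eq_one_iff_mem_frontier hU0.2.1 hnU).1 hqU,
      (gauge_eq_one_iff_mem_frontier hV0.2.1 hnV).1 hqV⟩, ?_, ?_, ?_, ?_⟩
  · simp [crossProdRight, crossProd]; ring
  · simp [crossProdRight, crossProd]; ring
  · intro x hx
    obtain ⟨r, θ, hr, rfl, hlt⟩ := exists_polar_of_mem_diff hU0 hnU hV hnV' hx
    obtain ⟨θ', hθ', he⟩ := hUs θ hlt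
    rw [he] at hx ⊢
    have hx1 := (mem_iff_gauge_le_one hU0 hnU).1 hx.1
    have hx2 := not_le.1 fun h => hx.2 (hV0V ((mem_iff_gauge_le_one hV0 hnV).2 h))
    rw [← unitVec_periodic φ] at hpU hpV
    have := crossProd_add_le hU0.2.1 hnU hV0.2.1 hnV hσ hρ hr (by linarith) hθ' hqU hpU hqV hpV
      hx1 hx2
    rw [unitVec_periodic φ] at this
    simp only [crossProdRight, crossProd, LinearMap.coe_mk, AddHom.coe_mk, PiLp.sub_apply] at this ⊢
    linarith
  · intro x hx
    obtain ⟨r, θ, hr, rfl, hlt⟩ := exists_polar_of_mem_diff hV0 hnV hU hnU' hx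
    obtain ⟨θ', hθ', he⟩ := hVs θ hlt
    rw [he] at hx ⊢
    have hx1 := (mem_iff_gauge_le_one hV0 hnV).1 hx.1
    have hx2 := not_le.1 fun h => hx.2 (hU0U ((mem_iff_gauge_le_one hU0 hnU).2 h))
    have := crossProd_add_le hV0.2.1 hnV hU0.2.1 hnU hρ hσ hr hψφ hθ' hpV hqV hpU hqU hx1 hx2
    simp only [crossProdRight, crossProd, LinearMap.coe_mk, AddHom.coe_mk, PiLp.sub_apply] at this ⊢
    linarith

theorem IsConvexBody.preimage_addLeft {S : Set Plane} (hS : IsConvexBody S) (o : Plane) :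
    IsConvexBody (Homeomorph.addLeft o ⁻¹' S) := by
  refine ⟨(Homeomorph.isCompact_preimage _).2 hS.1, hS.2.1.translate_preimage_right o, ?_⟩
  rw [← Homeomorph.preimage_interior]
  exact hS.2.2.preimage (Homeomorph.surjective _)

theorem interior_inter_halfSpaces_eq_empty {f : Plane →ₗ[ℝ] ℝ} (hf : f ≠ 0) (c : ℝ)
    (A B : Set Plane) :
    interior (A ∩ {x | f x ≤ c}) ∩ interior (B ∩ {x | c ≤ f x}) = ∅ := by
  rw [← interior_inter, ← image_eq_empty (f := f)]
  have ho := f.isOpenMap_of_finiteDimensional (LinearMap.surjective hf) _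
    (isOpen_interior (s := A ∩ {x | f x ≤ c} ∩ (B ∩ {x | c ≤ f x})))
  have hs : f '' interior (A ∩ {x | f x ≤ c} ∩ (B ∩ {x | c ≤ f x})) ⊆ {c} := by
    rintro _ ⟨x, hx, rfl⟩
    have h := interior_subset hx
    exact le_antisymm h.1.2 h.2.2
  rw [← subset_empty_iff, ← interior_singleton c]
  exact interior_maximal hs ho

theorem petal_separation
    (U V U0 V0 : Set Plane)
    (hU : IsConvexBody U) (hV : IsConvexBody V)
    (hU0 : IsConvexBody U0) (hV0 : IsConvexBody V0)
    (hcross : ∃ p₁ p₂ : Plane, p₁ ≠ p₂ ∧ frontier U ∩ frontier V = {p₁, p₂})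
    (hUV : (U \ V).Nonempty) (hVU : (V \ U).Nonempty)
    (hU0U : U0 ⊆ U) (hV0V : V0 ⊆ V)
    (hint : (interior U0 ∩ interior V0).Nonempty)
    (hU0V : (U0 \ V).Nonempty) (hV0U : (V0 \ U).Nonempty) :
    ∃ (f : Plane →ₗ[ℝ] ℝ) (c : ℝ) (p q : Plane), f ≠ 0 ∧ p ≠ q ∧
      p ∈ frontier U0 ∩ frontier V0 ∧ q ∈ frontier U0 ∩ frontier V0 ∧
      f p = c ∧ f q = c ∧
      (U0 \ V ⊆ {x : Plane | f x ≤ c}) ∧ (V0 \ U ⊆ {x : Plane | c ≤ f x}) ∧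
      Convex ℝ (U0 ∩ {x : Plane | f x ≤ c}) ∧
      Convex ℝ (V0 ∩ {x : Plane | c ≤ f x}) ∧
      interior (U0 ∩ {x : Plane | f x ≤ c}) ∩
        interior (V0 ∩ {x : Plane | c ≤ f x}) = ∅ ∧
      (U0 \ V ⊆ U0 ∩ {x : Plane | f x ≤ c}) ∧
      (V0 \ U ⊆ V0 ∩ {x : Plane | c ≤ f x}) ∧
      (U0 \ (U0 ∩ {x : Plane | f x ≤ c}) ⊆ V) ∧
      (V0 \ (V0 ∩ {x : Plane | c ≤ f x}) ⊆ U) := by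
  obtain ⟨o, hoU, hoV⟩ := hint
  set τ := Homeomorph.addLeft o
  have hnhds : ∀ {S : Set Plane}, o ∈ interior S → τ ⁻¹' S ∈ nhds 0 := by
    intro S h
    refine τ.continuous.continuousAt.preimage_mem_nhds ?_
    rw [show τ 0 = o from add_zero o]
    exact mem_interior_iff_mem_nhds.1 h
  have hcross' : ∃ p₁ p₂ : Plane, p₁ ≠ p₂ ∧
      frontier (τ ⁻¹' U) ∩ frontier (τ ⁻¹' V) = {p₁, p₂} := by
    obtain ⟨p₁, p₂, hne, h⟩ := hcross
    refine ⟨τ.symm p₁, τ.symm p₂, τ.symm.injective.ne hne, ?_⟩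
    rw [← τ.preimage_frontier, ← τ.preimage_frontier, ← preimage_inter, h,
      ← τ.image_symm, image_pair]
  obtain ⟨f, c, p, q, hf, hpq, hp, hq, hfp, hfq, hfU, hfV⟩ :=
    exists_separating_chord_of_mem_nhds (hU.preimage_addLeft o) (hV.preimage_addLeft o)
      (hU0.preimage_addLeft o) (hV0.preimage_addLeft o) hcross' (preimage_mono hU0U)
      (preimage_mono hV0V) (hnhds hoU) (hnhds hoV) (hU0V.preimage τ.surjective)
      (hV0U.preimage τ.surjective)
  rw [← τ.preimage_frontier, ← τ.preimage_frontier, ← preimage_inter] at hp hq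
  have hU' : ∀ x ∈ U0 \ V, f x ≤ f o + c := by
    intro x hx
    have h := hfU (x - o) (show o + (x - o) ∈ U0 \ V by rwa [add_sub_cancel])
    rw [map_sub] at h
    linarith
  have hV' : ∀ x ∈ V0 \ U, f o + c ≤ f x := by
    intro x hx
    have h := hfV (x - o) (show o + (x - o) ∈ V0 \ U by rwa [add_sub_cancel])
    rw [map_sub] at h
    linarith
  refine ⟨f, f o + c, o + p, o + q, hf, fun h => hpq (add_left_cancel h), hp, hq,
    by rw [map_add, hfp], by rw [map_add, hfq], hU', hV',
    hU0.2.1.inter (convex_halfSpace_le f.isLinear _),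
    hV0.2.1.inter (convex_halfSpace_ge f.isLinear _),
    interior_inter_halfSpaces_eq_empty hf _ _ _, fun x hx => ⟨hx.1, hU' x hx⟩,
    fun x hx => ⟨hx.1, hV' x hx⟩, ?_, ?_⟩
  · rintro x ⟨hx, hn⟩
    by_contra h
    exact hn ⟨hx, hU' x ⟨hx, h⟩⟩
  · rintro x ⟨hx, hn⟩
    by_contra h
    exact hn ⟨hx, hV' x ⟨hx, h⟩⟩
end

section
/- Let U and V be convex bodies in ℝ² with U \ V ≠ ∅ and V \ U ≠ ∅, and suppose frontier U ∩ frontier V = {p₁, p₂} for two distinct points p₁ ≠ p₂. Then there exist a nonzero linear functional f on ℝ² and a real number c with f(p₁) = f(p₂) = c such that U \ V ⊆ {x : f(x) ≤ c} and V \ U ⊆ {x : f(x) ≥ c}; that is, the line through p₁ and p₂ separates the plane into two closed half-planes, one containing U \ V and the other containing V \ U. -/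
open Set

/-- The functional `x ↦ det (d, x)`, whose kernel is the line spanned by `d` when `d ≠ 0`. -/
noncomputable def planeCross (d : Plane) : Plane →ₗ[ℝ] ℝ where
  toFun x := d 0 * x 1 - d 1 * x 0
  map_add' x y := by simp only [PiLp.add_apply]; ring
  map_smul' r x := by simp only [PiLp.smul_apply, smul_eq_mul, RingHom.id_apply]; ring

lemma planeCross_apply (d x : Plane) : planeCross d x = d 0 * x 1 - d 1 * x 0 := rfl

lemma planeCross_smul_eq (d e x : Plane) :
    planeCross d e • x = planeCross d x • e + planeCross x e • d := by
  ext i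
  fin_cases i <;> simp [planeCross_apply] <;> ring

lemma planeCross_ne_zero {d : Plane} (hd : d ≠ 0) : planeCross d ≠ 0 := by
  intro h
  apply hd
  have h₀ := LinearMap.congr_fun h (EuclideanSpace.single 0 1)
  have h₁ := LinearMap.congr_fun h (EuclideanSpace.single 1 1)
  simp [planeCross_apply] at h₀ h₁
  ext i
  fin_cases i <;> simp [h₀, h₁]

/-- A linear functional on the plane vanishing on two independent vectors vanishes. -/
lemma apply_eq_zero_of_planeCross_ne_zero {d e : Plane} (h : planeCross d e ≠ 0)
    (g : Plane →L[ℝ] ℝ) (hd : g d = 0) (he : g e = 0) (x : Plane) : g x = 0 := by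
  have := congrArg g (planeCross_smul_eq d e x)
  simpa [hd, he, h] using this

lemma IsConvexBody.subset_closure_interior {U : Set Plane} (hU : IsConvexBody U) :
    U ⊆ closure (interior U) := by
  rw [hU.2.1.closure_interior_eq_closure_of_nonempty_interior hU.2.2]
  exact subset_closure

/-- A point of a convex body off a chord is joined to the midpoint of the chord through interior
points. -/
lemma IsConvexBody.lineMap_mem_interior {U : Set Plane} (hU : IsConvexBody U) {p q x : Plane}
    (hp : p ∈ U) (hq : q ∈ U) (hx : x ∈ U) (h : planeCross (q - p) (x - midpoint ℝ p q) ≠ 0)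
    {s : ℝ} (hs₀ : 0 < s) (hs₁ : s < 1) :
    AffineMap.lineMap (midpoint ℝ p q) x s ∈ interior U := by
  by_contra hz
  obtain ⟨g, hg⟩ := geometric_hahn_banach_open_point hU.2.1.interior isOpen_interior hz
  set z := AffineMap.lineMap (midpoint ℝ p q) x s with hz_def
  have hle : ∀ a ∈ U, g a ≤ g z := fun a ha =>
    closure_minimal (fun b hb => (hg b hb).le) (isClosed_le g.continuous continuous_const)
      (hU.subset_closure_interior ha)
  have hgz : g z = (1 - s) * ((g p + g q) / 2) + s * g x := by
    rw [hz_def, AffineMap.lineMap_apply_module, midpoint_eq_smul_add]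
    simp
    ring
  have h₁ := hle p hp
  have h₂ := hle q hq
  have h₃ := hle x hx
  have hgx : g x = g z := by nlinarith
  have hgm : (g p + g q) / 2 = g z := by nlinarith
  have hd : g (q - p) = 0 := by rw [map_sub]; linarith
  have he : g (x - midpoint ℝ p q) = 0 := by
    rw [midpoint_eq_smul_add]
    simp
    linarith
  obtain ⟨w, hw⟩ := hU.2.2
  have := hg w hw
  simp [apply_eq_zero_of_planeCross_ne_zero h g hd he] at this

/-- If a convex set contains a chord and a point on one side of it, then every ray from the
midpoint of the chord into that side starts inside the set. -/
lemma Convex.exists_pos_midpoint_add_smul_mem {U : Set Plane} (hU : Convex ℝ U) {p q x : Plane}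
    (hp : p ∈ U) (hq : q ∈ U) (hx : x ∈ U)
    (h : 0 < planeCross (q - p) (x - midpoint ℝ p q)) {d : Plane}
    (hd : 0 < planeCross (q - p) d) :
    ∃ s : ℝ, 0 < s ∧ midpoint ℝ p q + s • d ∈ U := by
  set m := midpoint ℝ p q with hm
  set k := planeCross (q - p) (x - m)
  set a := planeCross (q - p) d
  set b := planeCross d (x - m)
  have hk : k • d = a • (x - m) + b • (q - p) := planeCross_smul_eq _ _ _
  have hmU : m ∈ U := hU.midpoint_mem hp hq
  have hN : 0 < 2 * (a + 2 * |b|) := by positivity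
  set r := (2 * (a + 2 * |b|))⁻¹
  have hr₀ : 0 < r := inv_pos.mpr hN
  have hrN : r * (2 * (a + 2 * |b|)) = 1 := inv_mul_cancel₀ hN.ne'
  have hb : 0 ≤ r * |b| := by positivity
  have hra : 0 < r * a := by positivity
  have hab : |r * b| = r * |b| := by rw [abs_mul, abs_of_pos hr₀]
  have hb' := abs_le.mp (le_of_eq hab)
  refine ⟨r * k, by positivity, ?_⟩
  have h₁ : (1 - 2 * (r * a)) • m + (2 * (r * a)) • x ∈ U :=
    hU hmU hx (by nlinarith) (by positivity) (by ring)
  have h₂ : (1 / 2 - 2 * (r * b)) • p + (1 / 2 + 2 * (r * b)) • q ∈ U :=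
    hU hp hq (by nlinarith) (by nlinarith) (by ring)
  convert hU h₁ h₂ (a := 1 / 2) (b := 1 / 2) (by norm_num) (by norm_num) (by norm_num) using 1
  rw [mul_smul, hk, hm, midpoint_eq_smul_add, invOf_eq_inv]
  module

/-- Points lying on a common ray from a common point of two convex sets cannot witness both
differences. -/
lemma Convex.not_mem_ray_diff_and_diff {E : Type*} [AddCommGroup E] [Module ℝ E] {U V : Set E}
    (hU : Convex ℝ U) (hV : Convex ℝ V) {m d : E} (hmU : m ∈ U) (hmV : m ∈ V) {s t : ℝ}
    (hs : 0 < s) (ht : 0 < t) (hsU : m + s • d ∈ U) (hsV : m + s • d ∉ V)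
    (htV : m + t • d ∈ V) (htU : m + t • d ∉ U) : False := by
  have key : ∀ {W : Set E}, Convex ℝ W → m ∈ W → ∀ {a b : ℝ}, 0 < a → a ≤ b →
      m + b • d ∈ W → m + a • d ∈ W := by
    intro W hW hm a b ha hab hb
    have hb₀ : 0 < b := ha.trans_le hab
    have := hW.add_smul_mem hm hb (t := a / b) ⟨by positivity, (div_le_one hb₀).mpr hab⟩
    rwa [smul_smul, div_mul_cancel₀ _ hb₀.ne'] at this
  rcases le_total s t with h | h
  · exact hsV (key hV hmV hs h htV)
  · exact htU (key hU hmU ht h hsU)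

/-- The points `z` such that the ray from `m` through `z` meets the interior of `U` outside `V`. -/
def rayDominance (m : Plane) (U V : Set Plane) : Set Plane :=
  {z | ∃ s : ℝ, 0 < s ∧ m + s • (z - m) ∈ interior U \ V}

lemma isOpen_rayDominance (m : Plane) (U : Set Plane) {V : Set Plane} (hV : IsClosed V) :
    IsOpen (rayDominance m U V) := by
  have : rayDominance m U V =
      ⋃ s ∈ Ioi (0 : ℝ), (fun z : Plane => m + s • (z - m)) ⁻¹' (interior U \ V) := by
    ext z
    simp only [rayDominance, mem_ofPred_eq, mem_iUnion, mem_preimage, mem_Ioi, exists_prop]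
  rw [this]
  exact isOpen_biUnion fun s _ => (isOpen_interior.sdiff hV).preimage (by fun_prop)

/-- A ray from the midpoint of a chord of `U` which leaves the chord and meets `U` outside `V`
meets the interior of `U` outside `V`. -/
lemma IsConvexBody.mem_rayDominance {U V : Set Plane} (hU : IsConvexBody U) (hV : IsClosed V)
    {p q z : Plane} (hp : p ∈ U) (hq : q ∈ U)
    (hz : 0 < planeCross (q - p) (z - midpoint ℝ p q)) {s : ℝ} (hs : 0 < s)
    (hsU : midpoint ℝ p q + s • (z - midpoint ℝ p q) ∈ U)
    (hsV : midpoint ℝ p q + s • (z - midpoint ℝ p q) ∉ V) :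
    z ∈ rayDominance (midpoint ℝ p q) U V := by
  set m := midpoint ℝ p q
  have hcont : Continuous fun r : ℝ => m + r • (z - m) := by fun_prop
  have hnear : ∀ᶠ r in nhds s, m + r • (z - m) ∉ V :=
    hcont.continuousAt.eventually (hV.isOpen_compl.mem_nhds hsV)
  obtain ⟨r, hrs, hr₀, hrV⟩ :=
    ((frequently_lt_nhds s).and_eventually ((lt_mem_nhds hs).and hnear)).exists
  refine ⟨r, hr₀, ?_, hrV⟩
  have h := hU.lineMap_mem_interior hp hq hsU (s := r / s)
    (by rw [add_sub_cancel_left, map_smul, smul_eq_mul]; positivity) (by positivity)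
    ((div_lt_one hs).mpr hrs)
  rwa [AffineMap.lineMap_apply, vsub_eq_sub, vadd_eq_add, add_sub_cancel_left, smul_smul,
    div_mul_cancel₀ _ hs.ne', add_comm] at h

/-- If two convex bodies share a chord and each has a point uncovered by the other on the same
side of it, then their boundaries meet on that side. -/
lemma exists_mem_frontier_inter_of_planeCross_pos {U V : Set Plane} (hU : IsConvexBody U)
    (hV : IsConvexBody V) {p q x y : Plane} (hpU : p ∈ U) (hqU : q ∈ U) (hpV : p ∈ V) (hqV : q ∈ V)
    (hx : x ∈ U \ V) (hy : y ∈ V \ U) (hpx : 0 < planeCross (q - p) (x - midpoint ℝ p q))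
    (hpy : 0 < planeCross (q - p) (y - midpoint ℝ p q)) :
    ∃ z ∈ frontier U ∩ frontier V, 0 < planeCross (q - p) (z - midpoint ℝ p q) := by
  by_contra! hno
  set m := midpoint ℝ p q with hm
  have hmU : m ∈ U := hU.2.1.midpoint_mem hpU hqU
  have hmV : m ∈ V := hV.2.1.midpoint_mem hpV hqV
  have hUc := hU.1.isClosed
  have hVc := hV.1.isClosed
  have hH : Convex ℝ {z | 0 < planeCross (q - p) (z - m)} := by
    have : {z | 0 < planeCross (q - p) (z - m)} =
        {z | planeCross (q - p) m < planeCross (q - p) z} := by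
      ext z
      simp
    rw [this]
    exact convex_halfSpace_gt (planeCross (q - p)).isLinear _
  have hcover : {z | 0 < planeCross (q - p) (z - m)} ⊆
      rayDominance m U V ∪ rayDominance m V U := by
    intro z (hz : 0 < planeCross (q - p) (z - m))
    have hzm : z - m ≠ 0 := fun h => by simp [h] at hz
    have hcont : Continuous fun s : ℝ => m + s • (z - m) := by fun_prop
    have hemb : Topology.IsClosedEmbedding fun s : ℝ => m + s • (z - m) :=
      (Homeomorph.addLeft m).isClosedEmbedding.comp (isClosedEmbedding_smul_left hzm)
    have hcomp : IsCompact ((fun s : ℝ => m + s • (z - m)) ⁻¹' U) := hemb.isCompact_preimage hU.1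
    obtain ⟨r, hr₀, hrU⟩ := hU.2.1.exists_pos_midpoint_add_smul_mem hpU hqU hx.1 hpx hz
    obtain ⟨s, hsU, hmax⟩ := hcomp.exists_isGreatest ⟨r, hrU⟩
    have hs₀ : 0 < s := hr₀.trans_le (hmax hrU)
    have hsU' : m + s • (z - m) ∈ U := hsU
    by_cases hsV : m + s • (z - m) ∈ V
    · right
      have hlim : ∃ᶠ t in nhds s, m + t • (z - m) ∉ U ∧ 0 < t := by
        have : ∃ᶠ t in nhds s, s < t := frequently_gt_nhds s
        refine (this.and_eventually (lt_mem_nhds hs₀)).mono fun t ht => ⟨fun htU => ?_, ht.2⟩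
        exact (hmax htU).not_gt ht.1
      have hfU : m + s • (z - m) ∈ frontier U := by
        rw [hUc.frontier_eq]
        refine ⟨hsU', fun hi => ?_⟩
        obtain ⟨t, ht, htU⟩ := (hlim.and_eventually
          (hcont.continuousAt.eventually (isOpen_interior.mem_nhds hi))).exists
        exact ht.1 (interior_subset htU)
      have hiV : m + s • (z - m) ∈ interior V := by
        by_contra hi
        have hfV : m + s • (z - m) ∈ frontier V := by
          rw [hVc.frontier_eq]
          exact ⟨hsV, hi⟩
        have := hno _ ⟨hfU, hfV⟩
        rw [add_sub_cancel_left, map_smul, smul_eq_mul] at this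
        exact (mul_pos hs₀ hz).not_ge this
      obtain ⟨t, ht, htV⟩ := (hlim.and_eventually
        (hcont.continuousAt.eventually (isOpen_interior.mem_nhds hiV))).exists
      exact ⟨t, ht.2, htV, ht.1⟩
    · exact Or.inl (hU.mem_rayDominance hVc hpU hqU hz hs₀ hsU' hsV)
  obtain ⟨z, -, ⟨s, hs, hsU, hsV⟩, t, ht, htV, htU⟩ := hH.isPreconnected _ _
    (isOpen_rayDominance m U hVc) (isOpen_rayDominance m V hUc) hcover
    ⟨x, hpx, hU.mem_rayDominance hVc hpU hqU hpx one_pos (by simpa using hx.1)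
      (by simpa using hx.2)⟩
    ⟨y, hpy, hV.mem_rayDominance hUc hpV hqV hpy one_pos (by simpa using hy.1)
      (by simpa using hy.2)⟩
  exact hU.2.1.not_mem_ray_diff_and_diff hV.2.1 hmU hmV hs ht (interior_subset hsU) hsV
    (interior_subset htV) htU

/-- The uncovered part of a convex body is not contained in a line. -/
lemma IsConvexBody.exists_mem_diff_ne {U V : Set Plane} (hU : IsConvexBody U) (hV : IsClosed V)
    (hUV : (U \ V).Nonempty) {f : Plane →ₗ[ℝ] ℝ} (hf : f ≠ 0) (c : ℝ) :
    ∃ x ∈ U \ V, f x ≠ c := by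
  obtain ⟨x, hxU, hxV⟩ := hUV
  obtain ⟨w, hwV, hwU⟩ := mem_closure_iff.mp (hU.subset_closure_interior hxU) _ hV.isOpen_compl hxV
  obtain ⟨v, hv⟩ : ∃ v, f v ≠ 0 := by
    by_contra! h
    exact hf (LinearMap.ext h)
  by_contra! hc
  have hcont : Continuous fun t : ℝ => w + t • v := by fun_prop
  have hev : ∀ᶠ t in nhds (0 : ℝ), w + t • v ∈ interior U \ V :=
    hcont.continuousAt.eventually
      ((isOpen_interior.sdiff hV).mem_nhds (by simpa using ⟨hwU, hwV⟩))
  obtain ⟨t, ht, htU⟩ := ((frequently_gt_nhds (0 : ℝ)).and_eventually hev).exists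
  have h₁ := hc _ ⟨interior_subset hwU, hwV⟩
  have h₂ := hc _ ⟨interior_subset htU.1, htU.2⟩
  rw [map_add, map_smul, h₁, smul_eq_mul, add_eq_left] at h₂
  exact (mul_ne_zero ht.ne' hv) h₂

lemma planeCross_sub_midpoint (p q x : Plane) :
    planeCross (q - p) (x - midpoint ℝ p q) =
      planeCross (q - p) x - planeCross (q - p) p := by
  rw [midpoint_eq_smul_add]
  simp [planeCross_apply]
  ring

theorem line_through_crossings_separates_uncovered_parts
    (U V : Set Plane)
    (hU : IsConvexBody U) (hV : IsConvexBody V)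
    (hUV : (U \ V).Nonempty) (hVU : (V \ U).Nonempty)
    (p₁ p₂ : Plane) (hne : p₁ ≠ p₂)
    (hcross : frontier U ∩ frontier V = {p₁, p₂}) :
    ∃ (f : Plane →ₗ[ℝ] ℝ) (c : ℝ), f ≠ 0 ∧ f p₁ = c ∧ f p₂ = c ∧
      (U \ V ⊆ {x : Plane | f x ≤ c}) ∧ (V \ U ⊆ {x : Plane | c ≤ f x}) := by
  have hfin := fun {z} (hz : z ∈ ({p₁, p₂} : Set Plane)) => hcross.symm.subset hz
  have h₁ := hfin (mem_insert p₁ {p₂})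
  have h₂ := hfin (mem_insert_of_mem p₁ (mem_singleton p₂))
  have hUc := hU.1.isClosed
  have hVc := hV.1.isClosed
  have h₁U := hUc.frontier_subset h₁.1
  have h₁V := hVc.frontier_subset h₁.2
  have h₂U := hUc.frontier_subset h₂.1
  have h₂V := hVc.frontier_subset h₂.2
  set f := planeCross (p₂ - p₁) with hf
  have hf₀ : f ≠ 0 := planeCross_ne_zero (sub_ne_zero.mpr hne.symm)
  have hf₂ : f p₂ = f p₁ := by
    simp only [hf, planeCross_apply, PiLp.sub_apply]
    ring
  have hneg : ∀ x, planeCross (p₁ - p₂) (x - midpoint ℝ p₂ p₁) = f p₁ - f x := fun x => by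
    rw [planeCross_sub_midpoint]
    simp only [hf, planeCross_apply, PiLp.sub_apply]
    ring
  have hpos : ∀ x ∈ U \ V, ∀ y ∈ V \ U, f p₁ < f x → f y ≤ f p₁ := by
    intro x hx y hy hxf
    by_contra! hyf
    obtain ⟨z, hz, hzf⟩ := exists_mem_frontier_inter_of_planeCross_pos hU hV h₁U h₂U h₁V h₂V hx hy
      (by rw [planeCross_sub_midpoint]; linarith) (by rw [planeCross_sub_midpoint]; linarith)
    rw [planeCross_sub_midpoint] at hzf
    rw [hcross] at hz
    rcases hz with rfl | rfl <;> linarith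
  have hnegative : ∀ x ∈ U \ V, ∀ y ∈ V \ U, f x < f p₁ → f p₁ ≤ f y := by
    intro x hx y hy hxf
    by_contra! hyf
    obtain ⟨z, hz, hzf⟩ := exists_mem_frontier_inter_of_planeCross_pos hU hV h₂U h₁U h₂V h₁V hx hy
      (by rw [hneg]; linarith) (by rw [hneg]; linarith)
    rw [hneg] at hzf
    rw [hcross] at hz
    rcases hz with rfl | rfl <;> linarith
  obtain ⟨x, hx, hxf⟩ := hU.exists_mem_diff_ne hVc hUV hf₀ (f p₁)
  obtain ⟨y, hy, hyf⟩ := hV.exists_mem_diff_ne hUc hVU hf₀ (f p₁)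
  rcases hxf.lt_or_gt with hxf | hxf
  · have hy' := (hnegative x hx y hy hxf).lt_of_ne' hyf
    refine ⟨f, f p₁, hf₀, rfl, hf₂, fun a ha => ?_, fun b hb => hnegative x hx b hb hxf⟩
    by_contra! h
    exact (hpos a ha y hy (not_le.mp h)).not_gt hy'
  · have hy' := (hpos x hx y hy hxf).lt_of_ne hyf
    refine ⟨-f, -f p₁, neg_ne_zero.mpr hf₀, rfl, by simp [hf₂], fun a ha => ?_, fun b hb => ?_⟩
    · by_contra! h
      exact (hnegative a ha y hy (by simpa using h)).not_gt hy'
    · simpa using hpos x hx b hb hxf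
end

section
/- Let C ⊆ ℝ² be a convex body with 0 ∈ interior C, and let 𝔉 be a finite family of nonempty compact convex sets in ℝ². For S ∈ 𝔉, define Cell(S) := {p ∈ ℝ² : 𝔡_C(p, S) ≤ 𝔡_C(p, S') for all S' ∈ 𝔉}. Then Cell(S), equipped with the subspace topology, is a simply connected topological space. -/
open Set

/-- Convex distance from a point `p` to a set `S`, induced by the convex
body `C` via the Minkowski functional: `𝔡_C(p, S) = inf_{q ∈ S} gauge C (q - p)`. -/
noncomputable def convDist (C : Set Plane) (p : Plane) (S : Set Plane) : ℝ :=
  ⨅ q : S, gauge C ((q : Plane) - p)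

/-- The Voronoi cell of `S` among the sites `𝔉`, with respect to the convex
distance induced by `C`. -/
def vorCell (C : Set Plane) (𝔉 : Finset (Set Plane)) (S : Set Plane) :
    Set Plane :=
  {p : Plane | ∀ S' ∈ 𝔉, convDist C p S ≤ convDist C p S'}

open Filter Topology

theorem convexOn_gauge_sub {E : Type*} [NormedAddCommGroup E] [NormedSpace ℝ E] {C S : Set E}
    (hC : Convex ℝ C) (h0 : C ∈ 𝓝 0) (hS : Convex ℝ S) (p : E) :
    ConvexOn ℝ S fun q => gauge C (q - p) := by
  refine ⟨hS, fun x _ y _ a b ha hb hab => ?_⟩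
  have h : a • x + b • y - p = a • (x - p) + b • (y - p) := by
    rw [smul_sub, smul_sub, sub_add_sub_comm, ← add_smul, hab, one_smul]
  simp only [h]
  refine (gauge_add_le hC (absorbent_nhds_zero h0) _ _).trans ?_
  rw [gauge_smul_of_nonneg ha, gauge_smul_of_nonneg hb]

/-- The points of `S` nearest to `p` for the convex distance induced by `C`. -/
def nearestPoints {E : Type*} [AddCommGroup E] [Module ℝ E] (C S : Set E) (p : E) : Set E :=
  {q | q ∈ S ∧ ∀ s ∈ S, gauge C (q - p) ≤ gauge C (s - p)}

section

variable {E : Type*} [NormedAddCommGroup E] [NormedSpace ℝ E] {C S : Set E}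

theorem convex_nearestPoints (hC : Convex ℝ C) (h0 : C ∈ 𝓝 0) (hS : Convex ℝ S) (p : E) :
    Convex ℝ (nearestPoints C S p) := by
  intro x hx y hy a b ha hb hab
  refine ⟨hS hx.1 hy.1 ha hb hab, fun s hs => ?_⟩
  exact ((convexOn_gauge_sub hC h0 hS p).convex_le (gauge C (s - p))
    ⟨hx.1, hx.2 s hs⟩ ⟨hy.1, hy.2 s hs⟩ ha hb hab).2

theorem isClosed_graph_nearestPoints (hC : Convex ℝ C) (h0 : C ∈ 𝓝 0) (hS : IsClosed S) :
    IsClosed {x : E × E | x.2 ∈ nearestPoints C S x.1} := by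
  have hg := continuous_gauge hC h0
  have h : {x : E × E | x.2 ∈ nearestPoints C S x.1} = {x | x.2 ∈ S} ∩
      ⋂ s ∈ S, {x : E × E | gauge C (x.2 - x.1) ≤ gauge C (s - x.1)} := by
    ext x
    simp [nearestPoints]
  rw [h]
  refine (hS.preimage continuous_snd).inter (isClosed_biInter fun s _ => ?_)
  exact isClosed_le (hg.comp (continuous_snd.sub continuous_fst))
    (hg.comp (continuous_const.sub continuous_fst))

theorem nonempty_nearestPoints (hC : Convex ℝ C) (h0 : C ∈ 𝓝 0) (hS : IsCompact S)
    (hne : S.Nonempty) (p : E) : (nearestPoints C S p).Nonempty := by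
  obtain ⟨q, hq, hmin⟩ := hS.exists_isMinOn hne
    ((continuous_gauge hC h0).comp (continuous_id.sub (continuous_const (y := p)))).continuousOn
  exact ⟨q, hq, fun s hs => hmin hs⟩

theorem linearIndependent_of_mem_nearestPoints (h0 : C ∈ 𝓝 0)
    (hb : Bornology.IsBounded C) (hS : Convex ℝ S) {p a b : E}
    (ha : a ∈ nearestPoints C S p) (hb' : b ∈ nearestPoints C S p) (hab : a ≠ b) :
    LinearIndependent ℝ ![a - p, b - p] := by
  have hpos : ∀ x : E, 0 < gauge C x ↔ x ≠ 0 := fun x =>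
    gauge_pos (absorbent_nhds_zero h0) (NormedSpace.isVonNBounded_of_isBounded ℝ hb)
  have hd : gauge C (a - p) = gauge C (b - p) := le_antisymm (ha.2 b hb'.1) (hb'.2 a ha.1)
  have hp : p ∉ S := by
    intro hp
    have key : ∀ x ∈ nearestPoints C S p, x = p := by
      intro x hx
      by_contra hne
      have := (hpos (x - p)).2 (sub_ne_zero.2 hne)
      have := hx.2 p hp
      rw [sub_self, gauge_zero] at this
      linarith
    exact hab ((key a ha).trans (key b hb').symm)
  have ha0 : a - p ≠ 0 := fun h => hp (sub_eq_zero.1 h ▸ ha.1)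
  have hda := (hpos _).2 ha0
  rw [LinearIndependent.pair_iff' ha0]
  intro c hc
  rcases le_or_gt 0 c with h | h
  · rw [← hc, gauge_smul_of_nonneg h, smul_eq_mul] at hd
    have hc1 : c = 1 := by
      have : (c - 1) * gauge C (a - p) = 0 := by linarith
      rcases mul_eq_zero.1 this with h | h <;> linarith
    rw [hc1, one_smul] at hc
    exact hab (sub_left_inj.1 hc)
  · apply hp
    have hc' : (0 : ℝ) < 1 - c := by linarith
    have hmem := hS ha.1 hb'.1 (a := -c / (1 - c)) (b := 1 / (1 - c))
      (div_nonneg (by linarith) hc'.le) (by positivity) (by field_simp; ring)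
    have hbe : b = p + c • (a - p) := by rw [hc]; abel
    have : (-c / (1 - c)) • a + (1 / (1 - c)) • b = p := by
      rw [hbe]
      match_scalars <;> field_simp <;> ring
    rwa [this] at hmem

/-- In the plane, the gauge is linear around a point that sees the inside of a segment of nearest
points. -/
theorem exists_gauge_eventuallyEq_linear (hE : Module.finrank ℝ E = 2) (hC : Convex ℝ C)
    (h0 : C ∈ 𝓝 0) (hb : Bornology.IsBounded C) (hS : Convex ℝ S) {p a b m : E}
    (ha : a ∈ nearestPoints C S p) (hb' : b ∈ nearestPoints C S p) (hab : a ≠ b)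
    (hm : m ∈ openSegment ℝ a b) :
    ∃ f : E →ₗ[ℝ] ℝ, ∀ᶠ x in 𝓝 (m - p), gauge C x = f x := by
  have : FiniteDimensional ℝ E := FiniteDimensional.of_finrank_pos (by omega)
  let B := basisOfLinearIndependentOfCardEqFinrank
    (linearIndependent_of_mem_nearestPoints h0 hb hS ha hb' hab) (by simp [hE])
  have hB : ∀ x, x = B.coord 0 x • (a - p) + B.coord 1 x • (b - p) := fun x => by
    have := B.sum_repr x
    rw [Fin.sum_univ_two] at this
    simpa [B] using this.symm
  have hB0 : B 0 = a - p := by simp [B]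
  have hB1 : B 1 = b - p := by simp [B]
  have hcoord : ∀ i, 0 < B.coord i (m - p) := by
    obtain ⟨α, β, hα, hβ, hαβ, rfl⟩ := hm
    have hm : α • a + β • b - p = α • B 0 + β • B 1 := by
      rw [hB0, hB1, smul_sub, smul_sub, sub_add_sub_comm, ← add_smul, hαβ, one_smul]
    intro i
    rw [hm]
    fin_cases i <;> simp [hα, hβ]
  refine ⟨gauge C (a - p) • (B.coord 0 + B.coord 1), ?_⟩
  have hev : ∀ i, ∀ᶠ x in 𝓝 (m - p), 0 < B.coord i x := fun i =>
    ((B.coord i).continuous_of_finiteDimensional.tendsto _).eventually (lt_mem_nhds (hcoord i))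
  filter_upwards [hev 0, hev 1] with x hx0 hx1
  have hsum : 0 < B.coord 0 x + B.coord 1 x := by positivity
  set α := B.coord 0 x with hα
  set β := B.coord 1 x with hβ
  have hmem := convex_nearestPoints hC h0 hS p ha hb' (a := α / (α + β)) (b := β / (α + β))
    (by positivity) (by positivity) (by field_simp)
  have hx : x = (α + β) • ((α / (α + β)) • a + (β / (α + β)) • b - p) := by
    rw [hB x, ← hα, ← hβ]
    match_scalars <;> field_simp
    ring
  have hgauge := le_antisymm (hmem.2 a ha.1) (ha.2 _ hmem.1)
  calc gauge C x = (α + β) * gauge C (a - p) := by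
        rw [hx, gauge_smul_of_nonneg hsum.le, smul_eq_mul, hgauge]
    _ = _ := by simp [hα, hβ, mul_comm, mul_add]

theorem eventually_mem_nearestPoints (hE : Module.finrank ℝ E = 2) (hC : Convex ℝ C)
    (h0 : C ∈ 𝓝 0) (hb : Bornology.IsBounded C) (hS : Convex ℝ S) {p a b m : E}
    (ha : a ∈ nearestPoints C S p) (hb' : b ∈ nearestPoints C S p) (hab : a ≠ b)
    (hm : m ∈ openSegment ℝ a b) : ∀ᶠ p' in 𝓝 p, m ∈ nearestPoints C S p' := by
  obtain ⟨f, hf⟩ := exists_gauge_eventuallyEq_linear hE hC h0 hb hS ha hb' hab hm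
  have hmN : m ∈ nearestPoints C S p :=
    (convex_nearestPoints hC h0 hS p).openSegment_subset ha hb' hm
  have hf2 : ∀ᶠ x : E × E in 𝓝 (p, m), gauge C (x.2 - x.1) = f (x.2 - x.1) :=
    ((continuous_snd.sub continuous_fst).tendsto (p, m)).eventually hf
  have hf3 := hf2.curry_nhds
  have hp := hf3.self_of_nhds
  filter_upwards [hf3] with p' hp'
  refine ⟨hmN.1, fun s hs => ?_⟩
  refine IsMinOn.of_isLocalMinOn_of_convexOn hmN.1 ?_ (convexOn_gauge_sub hC h0 hS p') hs
  filter_upwards [nhdsWithin_le_nhds hp', nhdsWithin_le_nhds hp, self_mem_nhdsWithin]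
    with x hx' hx hxS
  have h := hmN.2 x hxS
  have hm1 := hp.self_of_nhds
  have hm2 := hp'.self_of_nhds
  simp only at hx hx' hm1 hm2
  rw [hx, hm1] at h
  rw [hx', hm2]
  simp only [map_sub] at h ⊢
  linarith

end

/-- In the plane, the nearest points of a compact convex set can be selected continuously. -/
theorem exists_continuous_mem_nearestPoints {E : Type*} [NormedAddCommGroup E]
    [InnerProductSpace ℝ E] {C S : Set E} (hE : Module.finrank ℝ E = 2) (hC : Convex ℝ C)
    (h0 : C ∈ 𝓝 0) (hb : Bornology.IsBounded C) (hS : Convex ℝ S) (hSc : IsCompact S)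
    (hne : S.Nonempty) : ∃ r : E → E, Continuous r ∧ ∀ p, r p ∈ nearestPoints C S p := by
  have hgraph := isClosed_graph_nearestPoints hC h0 hSc.isClosed
  have hmin : ∀ p, ∃ q ∈ nearestPoints C S p, IsMinOn norm (nearestPoints C S p) q := fun p => by
    have hcl : IsClosed (nearestPoints C S p) :=
      hgraph.preimage (continuous_const.prodMk continuous_id : Continuous fun q => (p, q))
    exact (hSc.of_isClosed_subset hcl fun q hq => hq.1).exists_isMinOn
      (nonempty_nearestPoints hC h0 hSc hne p) continuous_norm.continuousOn
  choose r hr hrmin using hmin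
  refine ⟨r, continuous_iff_continuousAt.2 fun p => ?_, hr⟩
  refine hSc.tendsto_nhds_of_unique_mapClusterPt (Eventually.of_forall fun x => (hr x).1)
    fun q _ hq => ?_
  have hclosed : ∀ T : Set (E × E), IsClosed T → (∀ᶠ x in 𝓝 p, (x, r x) ∈ T) → (p, q) ∈ T := by
    intro T hT hev
    have hcl : MapClusterPt (p, q) (𝓝 p) fun x => (x, r x) := by
      rw [mapClusterPt_iff_frequently]
      intro s hs
      obtain ⟨u, hu, v, hv, huv⟩ := mem_nhds_prod_iff.1 hs
      exact ((mapClusterPt_iff_frequently.1 hq v hv).and_eventually hu).mono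
        fun x hx => huv ⟨hx.2, hx.1⟩
    exact isClosed_iff_clusterPt.1 hT _ 
      (ClusterPt.mono hcl (le_principal_iff.2 hev))
  have hqN : q ∈ nearestPoints C S p := hclosed _ hgraph (Eventually.of_forall hr)
  by_contra hne'
  have hm : midpoint ℝ q (r p) ∈ openSegment ℝ q (r p) := by
    rw [openSegment_eq_image_lineMap]
    exact ⟨1 / 2, by norm_num, by simp [midpoint]⟩
  have hlt : ‖midpoint ℝ q (r p)‖ < ‖q‖ := by
    obtain ⟨α, β, hα, hβ, hαβ, h⟩ := hm
    rw [← h]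
    exact norm_combo_lt_of_ne le_rfl (hrmin p hqN) hne' hα hβ hαβ
  have hle : ‖q‖ ≤ ‖midpoint ℝ q (r p)‖ :=
    hclosed {x | ‖x.2‖ ≤ ‖midpoint ℝ q (r p)‖} (isClosed_le continuous_snd.norm continuous_const)
      ((eventually_mem_nearestPoints hE hC h0 hb hS hqN (hr p) hne' hm).mono
        fun x hx => hrmin x hx)
  linarith

theorem convDist_le (C : Set Plane) (p : Plane) {S : Set Plane} {q : Plane} (hq : q ∈ S) :
    convDist C p S ≤ gauge C (q - p) :=
  ciInf_le ⟨0, by rintro _ ⟨x, rfl⟩; exact gauge_nonneg _⟩ (⟨q, hq⟩ : S)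

theorem le_convDist {C : Set Plane} {p : Plane} {S : Set Plane} (hS : S.Nonempty) {d : ℝ}
    (h : ∀ q ∈ S, d ≤ gauge C (q - p)) : d ≤ convDist C p S :=
  have := hS.to_subtype
  le_ciInf fun q => h q q.2

theorem lineMap_mem_vorCell {C : Set Plane} (hC : Convex ℝ C) (h0 : C ∈ 𝓝 0)
    {𝔉 : Finset (Set Plane)} (hne : ∀ S ∈ 𝔉, S.Nonempty) {S : Set Plane} (hS : S ∈ 𝔉)
    {p q : Plane} (hp : p ∈ vorCell C 𝔉 S) (hq : q ∈ nearestPoints C S p) {t : ℝ}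
    (ht : t ∈ Icc (0 : ℝ) 1) : AffineMap.lineMap p q t ∈ vorCell C 𝔉 S := by
  intro S' hS'
  set x := AffineMap.lineMap p q t with hx
  have hpx : x - p = t • (q - p) := by simp [hx, AffineMap.lineMap_apply]
  have hxq : q - x = (1 - t) • (q - p) := by
    rw [sub_smul, one_smul, ← hpx]; abel
  have hd : gauge C (q - p) ≤ convDist C p S' := (le_convDist (hne S hS) hq.2).trans (hp S' hS')
  refine (convDist_le C x hq.1).trans (le_convDist (hne S' hS') fun s hs => ?_)
  have htri : gauge C (s - p) ≤ gauge C (s - x) + gauge C (x - p) := by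
    simpa using gauge_add_le hC (absorbent_nhds_zero h0) (s - x) (x - p)
  have hs' := convDist_le C p hs
  rw [hpx, gauge_smul_of_nonneg ht.1, smul_eq_mul] at htri
  rw [hxq, gauge_smul_of_nonneg (by linarith [ht.2]), smul_eq_mul]
  linarith

theorem subset_vorCell {C : Set Plane} {𝔉 : Finset (Set Plane)} (hne : ∀ S ∈ 𝔉, S.Nonempty)
    (S : Set Plane) : S ⊆ vorCell C 𝔉 S := by
  intro p hp S' hS'
  refine (convDist_le C p hp).trans (le_convDist (hne S' hS') fun s _ => ?_)
  rw [sub_self, gauge_zero]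
  exact gauge_nonneg _

theorem voronoi_cell_simply_connected
    (C : Set Plane) (hCc : IsCompact C) (hCconv : Convex ℝ C)
    (h0 : (0 : Plane) ∈ interior C)
    (𝔉 : Finset (Set Plane))
    (hmem : ∀ S ∈ 𝔉, S.Nonempty ∧ IsCompact S ∧ Convex ℝ S)
    (S : Set Plane) (hS : S ∈ 𝔉) :
    SimplyConnectedSpace ↥(vorCell C 𝔉 S) := by
  have h0' := mem_interior_iff_mem_nhds.1 h0
  obtain ⟨hne, hSc, hSconv⟩ := hmem S hS
  have hne' : ∀ S ∈ 𝔉, S.Nonempty := fun S hS => (hmem S hS).1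
  obtain ⟨r, hrc, hr⟩ := exists_continuous_mem_nearestPoints (finrank_euclideanSpace_fin (𝕜 := ℝ))
    hCconv h0' hCc.isBounded hSconv hSc hne
  have : ContractibleSpace S := hSconv.contractibleSpace hne
  let ρ : C(vorCell C 𝔉 S, S) := ⟨fun p => ⟨r p, (hr p).1⟩, by fun_prop⟩
  let ι : C(S, vorCell C 𝔉 S) := ⟨Set.inclusion (subset_vorCell hne' S), continuous_inclusion _⟩
  let H : ContinuousMap.Homotopy (ContinuousMap.id (vorCell C 𝔉 S)) (ι.comp ρ) :=
    { toFun := fun x => ⟨AffineMap.lineMap (x.2 : Plane) (r x.2) (x.1 : ℝ),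
        lineMap_mem_vorCell hCconv h0' hne' hS x.2.2 (hr _) x.1.2⟩
      continuous_toFun := by
        refine Continuous.subtype_mk ?_ _
        simp only [AffineMap.lineMap_apply_module']
        fun_prop
      map_zero_left := fun x => by ext1; simp
      map_one_left := fun x => by ext1; simp [ρ, ι] }
  have : ContractibleSpace (vorCell C 𝔉 S) := by
    rw [contractible_iff_id_nullhomotopic]
    obtain ⟨y, hy⟩ := ((id_nullhomotopic S).comp_right ι).comp_left ρ
    exact ⟨y, ContinuousMap.Homotopic.trans ⟨H⟩ hy⟩
  infer_instance
end

section
/- Let C ⊆ ℝ² be a convex body with 0 ∈ interior C. Let S ⊆ ℝ² be a nonempty compact set and S' ⊆ ℝ² a nonempty set. Let z ∈ ℝ², let p ∈ S be a nearest point of S to z, i.e., gauge C (p − z) = 𝔡_C(z, S), and let x be any point on the segment [z, p]. If 𝔡_C(z, S) ≤ 𝔡_C(z, S'), then 𝔡_C(x, S) ≤ 𝔡_C(x, S'). -/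
open Set

theorem convDist_le_gauge (C : Set Plane) {S : Set Plane} (x : Plane) {q : Plane} (hq : q ∈ S) :
    convDist C x S ≤ gauge C (q - x) :=
  ciInf_le (f := fun q : S => gauge C ((q : Plane) - x))
    ⟨0, by rintro _ ⟨r, rfl⟩; exact gauge_nonneg _⟩ ⟨q, hq⟩

theorem nearest_site_along_segment
    (C : Set Plane) (hCc : IsCompact C) (hCconv : Convex ℝ C)
    (h0 : (0 : Plane) ∈ interior C)
    (S : Set Plane) (hSne : S.Nonempty) (hSc : IsCompact S)
    (S' : Set Plane) (hS'ne : S'.Nonempty)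
    (z p : Plane) (hp : p ∈ S)
    (hnear : gauge C (p - z) = convDist C z S)
    (x : Plane) (hx : x ∈ segment ℝ z p)
    (h : convDist C z S ≤ convDist C z S') :
    convDist C x S ≤ convDist C x S' := by
  obtain ⟨a, b, ha, hb, hab, rfl⟩ := hx
  have hzx : p - (a • z + b • p) = a • (p - z) := by
    obtain rfl : b = 1 - a := by linarith
    module
  have hxz : (a • z + b • p) - z = b • (p - z) := by
    obtain rfl : a = 1 - b := by linarith
    module
  have := hS'ne.to_subtype
  refine le_ciInf fun ⟨q, hq⟩ => ?_
  have hpx := convDist_le_gauge C (a • z + b • p) hp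
  have hqz := convDist_le_gauge C z hq
  have htri := gauge_add_le hCconv (absorbent_nhds_zero (mem_interior_iff_mem_nhds.1 h0))
    (q - (a • z + b • p)) ((a • z + b • p) - z)
  rw [sub_add_sub_cancel, hxz, gauge_smul_of_nonneg hb, smul_eq_mul] at htri
  rw [hzx, gauge_smul_of_nonneg ha, smul_eq_mul] at hpx
  obtain rfl : a = 1 - b := by linarith
  dsimp only
  linarith
end
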